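/- Let (A, G) be any of the pairs defining a quantum Kleinian singularity: (i) A = k_q[u,v] with G cyclic of order n acting by g·u = ωu, g·v = ω^{−1}v for ω a primitive nth root of unity; (ii) A = k_{−1}[u,v] with G = S_2 acting by h·u = v, h·v = u; (iii) A = k_{−1}[u,v] with G = D_n the dihedral group of order 2n acting by g·u = ωu, g·v = ω^{−1}v, h·u = v, h·v = u; (iv) A = k_J[u,v] with G = C_2 acting by u ↦ −u, v ↦ −v. Then the skew group ring A # G is a maximal order. -/

import Mathlib

/-- `T` together with `ι : A →+* T` and `j : G → T` is the skew group ring `A # G`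
for the action of the finite group `G` on `A`. -/
structure IsSkewGroupRing (A : Type*) [Ring A] (G : Type*) [Group G] [Fintype G]
    [MulSemiringAction G A] (T : Type*) [Ring T] (ι : A →+* T) (j : G → T) : Prop where
  injective : Function.Injective ι
  j_one : j 1 = 1
  j_mul : ∀ g h : G, j g * j h = j (g * h)
  comm : ∀ (g : G) (a : A), j g * ι a = ι (g • a) * j g
  basis : ∀ t : T, ∃! c : G → A, t = ∑ g : G, ι (c g) * j g

/-- `f : R →+* Q` exhibits `Q` as the (Goldie) classical quotient ring of `R`:
regular elements become units and every element of `Q` is left and a right fraction. -/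
structure IsGoldieQuotientRing {R Q : Type*} [Ring R] [Ring Q] (f : R →+* Q) : Prop where
  injective : Function.Injective f
  isUnit_of_regular : ∀ r : R, IsRegular r → IsUnit (f r)
  right_fraction : ∀ q : Q, ∃ a s : R, IsRegular s ∧ q * f s = f a
  left_fraction : ∀ q : Q, ∃ a s : R, IsRegular s ∧ f s * q = f a

/-- `R` (viewed inside its quotient ring `Q` via `f`) is a *maximal order*: there is no
ring `R ⊊ R' ⊆ Q` with `a R' b ⊆ R` for some nonzero `a, b ∈ R`. -/
def IsMaximalOrder {R Q : Type*} [Ring R] [Ring Q] (f : R →+* Q) : Prop :=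
  ¬ ∃ R' : Subring Q, f.range < R' ∧ ∃ a b : R, a ≠ 0 ∧ b ≠ 0 ∧
      ∀ x ∈ R', f a * x * f b ∈ f.range

/-- The relation defining the quantum plane `K_q[u,v]`: `v u = q · u v`. -/
inductive QuantumRel (K : Type*) [CommRing K] (q : K) :
    FreeAlgebra K (Fin 2) → FreeAlgebra K (Fin 2) → Prop
  | rel : QuantumRel K q (FreeAlgebra.ι K 1 * FreeAlgebra.ι K 0)
      (q • (FreeAlgebra.ι K 0 * FreeAlgebra.ι K 1))

/-- The quantum plane `K_q[u,v] = K⟨u,v⟩/(vu - q·uv)`. -/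
abbrev QuantumPlane (K : Type*) [CommRing K] (q : K) := RingQuot (QuantumRel K q)

/-- The generator `u` of the quantum plane. -/
noncomputable def qU (K : Type*) [CommRing K] (q : K) : QuantumPlane K q :=
  RingQuot.mkAlgHom K (QuantumRel K q) (FreeAlgebra.ι K 0)

/-- The generator `v` of the quantum plane. -/
noncomputable def qV (K : Type*) [CommRing K] (q : K) : QuantumPlane K q :=
  RingQuot.mkAlgHom K (QuantumRel K q) (FreeAlgebra.ι K 1)

/-- The relation defining the Jordan plane `K_J[u,v]`: `v u = u v + u²`. -/
inductive JordanRel (K : Type*) [CommRing K] :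
    FreeAlgebra K (Fin 2) → FreeAlgebra K (Fin 2) → Prop
  | rel : JordanRel K (FreeAlgebra.ι K 1 * FreeAlgebra.ι K 0)
      (FreeAlgebra.ι K 0 * FreeAlgebra.ι K 1 + FreeAlgebra.ι K 0 * FreeAlgebra.ι K 0)

/-- The Jordan plane `K_J[u,v] = K⟨u,v⟩/(vu - uv - u²)`. -/
abbrev JordanPlane (K : Type*) [CommRing K] := RingQuot (JordanRel K)

/-- The generator `u` of the Jordan plane. -/
noncomputable def jU (K : Type*) [CommRing K] : JordanPlane K :=
  RingQuot.mkAlgHom K (JordanRel K) (FreeAlgebra.ι K 0)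

/-- The generator `v` of the Jordan plane. -/
noncomputable def jV (K : Type*) [CommRing K] : JordanPlane K :=
  RingQuot.mkAlgHom K (JordanRel K) (FreeAlgebra.ι K 1)

/-- The monomial `u ^ i * v ^ j`, indexed by `(j, i)` in lexicographic order. -/
def mon {A : Type*} [Ring A] (u v : A) (m : ℕ ×ₗ ℕ) : A :=
  u ^ (ofLex m).2 * v ^ (ofLex m).1

/-- The total degree of the monomial indexed by `m`. -/
def tdeg (m : ℕ ×ₗ ℕ) : ℕ := (ofLex m).1 + (ofLex m).2

/-- `A` is the algebra on generators `u`, `v` with the single relation `v u = q u v + p u ^ 2`,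
where `q ≠ 0`; that is, the monomials `u ^ i * v ^ j` form a basis. -/
structure IsPBW {k A : Type*} [Field k] [Ring A] [Algebra k A] (q p : k) (u v : A) : Prop where
  q_ne : q ≠ 0
  rel : v * u = q • (u * v) + p • (u * u)
  linearIndependent : LinearIndependent k (mon u v)
  span : ⊤ ≤ Submodule.span k (Set.range (mon u v))

namespace IsPBW

variable {k A : Type*} [Field k] [Ring A] [Algebra k A] {q p : k} {u v : A}

/-- The monomial basis. -/
noncomputable def basis (h : IsPBW q p u v) : Module.Basis (ℕ ×ₗ ℕ) k A :=
  Module.Basis.mk h.linearIndependent h.span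

lemma basis_apply (h : IsPBW q p u v) (m : ℕ ×ₗ ℕ) : h.basis m = mon u v m := by
  simp [basis]

lemma coe_basis (h : IsPBW q p u v) : (h.basis : ℕ ×ₗ ℕ → A) = mon u v :=
  funext h.basis_apply

end IsPBW

section Monomials

variable {k A : Type*} [Field k] [Ring A] [Algebra k A] {q p : k} {u v : A}

lemma u_pow_mul_mon (u v : A) (i : ℕ) (m : ℕ ×ₗ ℕ) :
    u ^ i * mon u v m = mon u v (toLex (0, i) + m) := by
  simp [mon, ← mul_assoc, pow_add]

lemma u_mul_mon (u v : A) (m : ℕ ×ₗ ℕ) : u * mon u v m = mon u v (toLex (0, 1) + m) := by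
  simpa using u_pow_mul_mon u v 1 m

lemma exists_v_mul_u_pow (rel : v * u = q • (u * v) + p • (u * u)) (i : ℕ) :
    ∃ c : k, v * u ^ i = q ^ i • (u ^ i * v) + c • u ^ (i + 1) := by
  induction i with
  | zero => exact ⟨0, by simp⟩
  | succ i ih =>
    obtain ⟨c, hc⟩ := ih
    refine ⟨q ^ i * p + c, ?_⟩
    rw [pow_succ u i, ← mul_assoc, hc, add_mul, smul_mul_assoc, smul_mul_assoc, mul_assoc, rel]
    simp only [mul_add, mul_smul_comm, smul_add, smul_smul, ← mul_assoc, add_smul, pow_succ]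
    abel

lemma exists_v_mul_mon (rel : v * u = q • (u * v) + p • (u * u)) (m : ℕ ×ₗ ℕ) :
    ∃ c : k, v * mon u v m = q ^ (ofLex m).2 • mon u v (toLex (1, 0) + m) +
      c • mon u v (toLex (0, 1) + m) := by
  obtain ⟨c, hc⟩ := exists_v_mul_u_pow rel (ofLex m).2
  refine ⟨c, ?_⟩
  simp only [mon, ← mul_assoc, hc, add_mul, smul_mul_assoc]
  simp [mul_assoc, pow_add, (Commute.self_pow u (ofLex m).2).symm.left_comm]

/-- The elements all of whose monomials are smaller than `m`. -/
def Below (k : Type*) {A : Type*} [Field k] [Ring A] [Algebra k A] (u v : A) (m : ℕ ×ₗ ℕ) :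
    Submodule k A :=
  Submodule.span k (mon u v '' Set.Iio m)

/-- The leading monomial of `a` is the one indexed by `m`. -/
def IsLead (k : Type*) {A : Type*} [Field k] [Ring A] [Algebra k A] (u v : A) (a : A)
    (m : ℕ ×ₗ ℕ) : Prop :=
  ∃ c : k, c ≠ 0 ∧ a - c • mon u v m ∈ Below k u v m

lemma mon_mem_Below {m m' : ℕ ×ₗ ℕ} (h : m < m') : mon u v m ∈ Below k u v m' :=
  Submodule.subset_span ⟨m, h, rfl⟩

lemma Below_mono {m m' : ℕ ×ₗ ℕ} (h : m ≤ m') : Below k u v m ≤ Below k u v m' :=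
  Submodule.span_mono (Set.image_mono (Set.Iio_subset_Iio h))

lemma u_pow_mul_mem_Below (i : ℕ) {m : ℕ ×ₗ ℕ} {a : A} (ha : a ∈ Below k u v m) :
    u ^ i * a ∈ Below k u v (toLex (0, i) + m) := by
  induction ha using Submodule.span_induction with
  | mem x hx =>
    obtain ⟨m', hm', rfl⟩ := hx
    rw [u_pow_mul_mon]
    exact mon_mem_Below (by simpa using hm')
  | zero => simp
  | add x y _ _ hx hy => rw [mul_add]; exact add_mem hx hy
  | smul c x _ hx => rw [mul_smul_comm]; exact Submodule.smul_mem _ _ hx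

lemma toLex_zero_one_add_lt (m : ℕ ×ₗ ℕ) :
    (toLex (0, 1) + m : ℕ ×ₗ ℕ) < toLex (1, 0) + m := by
  apply add_lt_add_left
  simp [Prod.Lex.toLex_lt_toLex]

lemma v_mul_mem_Below (rel : v * u = q • (u * v) + p • (u * u)) {m : ℕ ×ₗ ℕ} {a : A}
    (ha : a ∈ Below k u v m) : v * a ∈ Below k u v (toLex (1, 0) + m) := by
  induction ha using Submodule.span_induction with
  | mem x hx =>
    obtain ⟨m', hm', rfl⟩ := hx
    obtain ⟨c, hc⟩ := exists_v_mul_mon rel m'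
    have h1 : (toLex (1, 0) + m' : ℕ ×ₗ ℕ) < toLex (1, 0) + m := by simpa using hm'
    rw [hc]
    exact add_mem (Submodule.smul_mem _ _ (mon_mem_Below h1))
      (Submodule.smul_mem _ _ (mon_mem_Below ((toLex_zero_one_add_lt m').trans h1)))
  | zero => simp
  | add x y _ _ hx hy => rw [mul_add]; exact add_mem hx hy
  | smul c x _ hx => rw [mul_smul_comm]; exact Submodule.smul_mem _ _ hx

lemma u_pow_mul_lead (i : ℕ) {m : ℕ ×ₗ ℕ} {a : A} (ha : IsLead k u v a m) :
    IsLead k u v (u ^ i * a) (toLex (0, i) + m) := by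
  obtain ⟨c, hc, h⟩ := ha
  refine ⟨c, hc, ?_⟩
  have := u_pow_mul_mem_Below i h
  rwa [mul_sub, mul_smul_comm, u_pow_mul_mon] at this

lemma v_mul_lead (hq : q ≠ 0) (rel : v * u = q • (u * v) + p • (u * u)) {m : ℕ ×ₗ ℕ} {a : A}
    (ha : IsLead k u v a m) : IsLead k u v (v * a) (toLex (1, 0) + m) := by
  obtain ⟨c, hc, h⟩ := ha
  obtain ⟨d, hd⟩ := exists_v_mul_mon rel m
  refine ⟨c * q ^ (ofLex m).2, mul_ne_zero hc (pow_ne_zero _ hq), ?_⟩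
  have := v_mul_mem_Below rel h
  rw [mul_sub, mul_smul_comm, hd, smul_add, smul_smul, sub_add_eq_sub_sub] at this
  have h2 := add_mem this (Submodule.smul_mem _ c (Submodule.smul_mem _ d
    (mon_mem_Below (k := k) (u := u) (v := v) (toLex_zero_one_add_lt m))))
  rwa [sub_add_cancel] at h2

lemma v_pow_mul_lead (hq : q ≠ 0) (rel : v * u = q • (u * v) + p • (u * u)) (j : ℕ)
    {m : ℕ ×ₗ ℕ} {a : A} (ha : IsLead k u v a m) :
    IsLead k u v (v ^ j * a) (toLex (j, 0) + m) := by
  induction j with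
  | zero =>
    have : (toLex (0, 0) : ℕ ×ₗ ℕ) = 0 := rfl
    simpa [this] using ha
  | succ j ih =>
    have := v_mul_lead hq rel ih
    rwa [← mul_assoc, ← pow_succ', ← add_assoc, ← toLex_add, Prod.mk_add_mk, add_comm 1 j] at this

lemma toLex_split (m : ℕ ×ₗ ℕ) :
    (toLex (0, (ofLex m).2) + toLex ((ofLex m).1, 0) : ℕ ×ₗ ℕ) = m := by
  rw [← toLex_add]; simp

lemma mon_mul_lead (hq : q ≠ 0) (rel : v * u = q • (u * v) + p • (u * u)) (m' : ℕ ×ₗ ℕ)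
    {m : ℕ ×ₗ ℕ} {a : A} (ha : IsLead k u v a m) :
    IsLead k u v (mon u v m' * a) (m' + m) := by
  have := u_pow_mul_lead (ofLex m').2 (v_pow_mul_lead hq rel (ofLex m').1 ha)
  rwa [← mul_assoc, ← add_assoc, toLex_split] at this

lemma IsLead.smul {a : A} {m : ℕ ×ₗ ℕ} (ha : IsLead k u v a m) {c : k} (hc : c ≠ 0) :
    IsLead k u v (c • a) m := by
  obtain ⟨d, hd, h⟩ := ha
  refine ⟨c * d, mul_ne_zero hc hd, ?_⟩
  rw [mul_smul, ← smul_sub]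
  exact Submodule.smul_mem _ _ h

lemma IsLead.add_below {a b : A} {m : ℕ ×ₗ ℕ} (ha : IsLead k u v a m) (hb : b ∈ Below k u v m) :
    IsLead k u v (a + b) m := by
  obtain ⟨d, hd, h⟩ := ha
  refine ⟨d, hd, ?_⟩
  rw [add_sub_right_comm]
  exact add_mem h hb

lemma isLead_mon (m : ℕ ×ₗ ℕ) : IsLead k u v (mon u v m) m := ⟨1, one_ne_zero, by simp⟩

lemma IsLead.mem_Below {a : A} {m m' : ℕ ×ₗ ℕ} (ha : IsLead k u v a m) (h : m < m') :
    a ∈ Below k u v m' := by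
  obtain ⟨c, -, hc⟩ := ha
  have := add_mem (Below_mono h.le hc) (Submodule.smul_mem _ c (mon_mem_Below h))
  rwa [sub_add_cancel] at this

/-- Leading monomials add up under multiplication. -/
lemma IsLead.mul (hq : q ≠ 0) (rel : v * u = q • (u * v) + p • (u * u)) {m m' : ℕ ×ₗ ℕ} {a b : A}
    (ha : IsLead k u v a m) (hb : IsLead k u v b m') : IsLead k u v (a * b) (m + m') := by
  obtain ⟨c, hc, h⟩ := ha
  have h1 : (a - c • mon u v m) * b ∈ Below k u v (m + m') := by
    generalize a - c • mon u v m = x at h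
    induction h using Submodule.span_induction with
    | mem x hx =>
      obtain ⟨m'', hm'', rfl⟩ := hx
      exact (mon_mul_lead hq rel m'' hb).mem_Below (by simpa using hm'')
    | zero => simp
    | add x y _ _ hx hy => rw [add_mul]; exact Submodule.add_mem _ hx hy
    | smul c x _ hx => rw [smul_mul_assoc]; exact Submodule.smul_mem _ _ hx
  have := ((mon_mul_lead hq rel m hb).smul hc).add_below h1
  rwa [sub_mul, smul_mul_assoc, add_sub_cancel] at this

namespace IsPBW

variable (h : IsPBW q p u v)
include h

lemma mem_Below_iff {a : A} {m : ℕ ×ₗ ℕ} :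
    a ∈ Below k u v m ↔ ∀ m', m ≤ m' → h.basis.repr a m' = 0 := by
  rw [Below, ← h.coe_basis, h.basis.mem_span_image]
  constructor
  · intro H m' hm'
    by_contra hne
    exact absurd (H (Finsupp.mem_support_iff.2 hne)) (not_lt.2 hm')
  · intro H m' hm'
    by_contra hne
    exact Finsupp.mem_support_iff.1 hm' (H m' (not_lt.1 hne))

lemma repr_mon (m m' : ℕ ×ₗ ℕ) : h.basis.repr (mon u v m) m' = if m = m' then 1 else 0 := by
  rw [← h.basis_apply, h.basis.repr_self, Finsupp.single_apply]

lemma isLead_iff {a : A} {m : ℕ ×ₗ ℕ} :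
    IsLead k u v a m ↔ h.basis.repr a m ≠ 0 ∧ ∀ m', m < m' → h.basis.repr a m' = 0 := by
  constructor
  · rintro ⟨c, hc, H⟩
    rw [h.mem_Below_iff] at H
    constructor
    · have := H m le_rfl
      simp only [map_sub, map_smul, Finsupp.sub_apply, Finsupp.smul_apply, h.repr_mon] at this
      simp only [if_true, smul_eq_mul, mul_one, sub_eq_zero] at this
      rwa [this]
    · intro m' hm'
      have := H m' hm'.le
      simpa [h.repr_mon, hm'.ne] using this
  · rintro ⟨h1, h2⟩
    refine ⟨_, h1, h.mem_Below_iff.2 fun m' hm' => ?_⟩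
    rcases hm'.eq_or_lt with rfl | hlt
    · simp [h.repr_mon]
    · simp [h.repr_mon, hlt.ne, h2 m' hlt]

lemma exists_isLead {a : A} (ha : a ≠ 0) : ∃ m, IsLead k u v a m := by
  have hs : (h.basis.repr a).support.Nonempty := by
    simpa using ha
  refine ⟨(h.basis.repr a).support.max' hs, h.isLead_iff.2 ⟨?_, ?_⟩⟩
  · exact Finsupp.mem_support_iff.1 (Finset.max'_mem _ hs)
  · intro m' hm'
    by_contra hne
    exact absurd (Finset.le_max' _ _ (Finsupp.mem_support_iff.2 hne)) (not_le.2 hm')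

lemma isLead_unique {a : A} {m m' : ℕ ×ₗ ℕ} (h1 : IsLead k u v a m) (h2 : IsLead k u v a m') :
    m = m' := by
  rw [h.isLead_iff] at h1 h2
  by_contra hne
  rcases lt_or_gt_of_ne hne with hlt | hlt
  · exact h2.1 (h1.2 _ hlt)
  · exact h1.1 (h2.2 _ hlt)

lemma isLead_ne_zero {a : A} {m : ℕ ×ₗ ℕ} (h1 : IsLead k u v a m) : a ≠ 0 := by
  rintro rfl
  exact (h.isLead_iff.1 h1).1 (by simp)

lemma mul_ne_zero {a b : A} (ha : a ≠ 0) (hb : b ≠ 0) : a * b ≠ 0 := by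
  obtain ⟨m, hm⟩ := h.exists_isLead ha
  obtain ⟨m', hm'⟩ := h.exists_isLead hb
  exact h.isLead_ne_zero (hm.mul h.q_ne h.rel hm')

lemma eq_zero_of_mul_eq_zero {a b : A} (ha : a ≠ 0) (hab : a * b = 0) : b = 0 := by
  by_contra hb
  exact h.mul_ne_zero ha hb hab

lemma u_ne_zero : u ≠ 0 := by
  have := h.linearIndependent.ne_zero (toLex (0, 1))
  simpa [mon] using this

lemma v_ne_zero : v ≠ 0 := by
  have := h.linearIndependent.ne_zero (toLex (1, 0))
  simpa [mon] using this

end IsPBW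

end Monomials

section MaximalOrder

/-- `J` is closed under multiplication by arbitrary elements on both sides. -/
structure IsTwoSided {T : Type*} [Ring T] (J : AddSubgroup T) : Prop where
  mul_left : ∀ t, ∀ a ∈ J, t * a ∈ J
  mul_right : ∀ t, ∀ a ∈ J, a * t ∈ J

/-- Every element of `Q` whose left multiplication stabilises a nonzero ideal of `T`
lies in `T`. -/
def LeftStable {T Q : Type*} [Ring T] [Ring Q] (f : T →+* Q) : Prop :=
  ∀ J : AddSubgroup T, IsTwoSided J → J ≠ ⊥ → ∀ x : Q,
    (∀ a ∈ J, ∃ b ∈ J, x * f a = f b) → ∃ t, x = f t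

lemma AddSubgroup.ne_bot_of_mem {T : Type*} [AddGroup T] {J : AddSubgroup T} {a : T} (ha : a ∈ J)
    (h : a ≠ 0) : J ≠ ⊥ := by
  rintro rfl
  exact h (by simpa using ha)

lemma isMaximalOrder_of_leftStable {T Q : Type*} [Ring T] [Ring Q] (f : T →+* Q)
    (hl : LeftStable f) (hr : LeftStable (RingHom.op f)) : IsMaximalOrder f := by
  rintro ⟨R', hlt, a, b, ha, hb, hab⟩
  have hf : ∀ t, f t ∈ R' := fun t => hlt.le ⟨t, rfl⟩
  refine hlt.not_ge fun x hx => ?_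
  have key : ∀ x ∈ R', ∃ t, f a * x = f t := by
    intro x hx
    let J : AddSubgroup T :=
      { carrier := {t | ∀ y ∈ R', ∃ s, f a * y * f t = f s}
        zero_mem' := fun y _ => ⟨0, by simp⟩
        add_mem' := by
          intro t t' h h' y hy
          obtain ⟨s, hs⟩ := h y hy
          obtain ⟨s', hs'⟩ := h' y hy
          exact ⟨s + s', by simp [mul_add, hs, hs']⟩
        neg_mem' := by
          intro t h y hy
          obtain ⟨s, hs⟩ := h y hy
          exact ⟨-s, by simp [hs]⟩ }
    refine hl J ⟨?_, ?_⟩ (AddSubgroup.ne_bot_of_mem (a := b) ?_ hb) _ ?_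
    · intro t c hc y hy
      obtain ⟨s, hs⟩ := hc (y * f t) (mul_mem hy (hf t))
      exact ⟨s, by rw [← hs]; simp [mul_assoc]⟩
    · intro t c hc y hy
      obtain ⟨s, hs⟩ := hc y hy
      exact ⟨s * t, by rw [map_mul, map_mul, ← hs]; simp [mul_assoc]⟩
    · intro y hy
      obtain ⟨s, hs⟩ := hab y hy
      exact ⟨s, hs.symm⟩
    · intro c hc
      obtain ⟨s, hs⟩ := hc x hx
      refine ⟨s, fun y hy => ?_, hs⟩
      obtain ⟨s', hs'⟩ := hc (y * f a * x) (mul_mem (mul_mem hy (hf a)) hx)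
      exact ⟨s', by rw [← hs', ← hs]; simp [mul_assoc]⟩
  let J : AddSubgroup Tᵐᵒᵖ :=
    { carrier := {t | ∀ y ∈ R', ∃ s, f t.unop * y = f s}
      zero_mem' := fun y _ => ⟨0, by simp⟩
      add_mem' := by
        intro t t' h h' y hy
        obtain ⟨s, hs⟩ := h y hy
        obtain ⟨s', hs'⟩ := h' y hy
        exact ⟨s + s', by simp [add_mul, hs, hs']⟩
      neg_mem' := by
        intro t h y hy
        obtain ⟨s, hs⟩ := h y hy
        exact ⟨-s, by simp [hs]⟩ }
  suffices h : ∃ t, MulOpposite.op x = RingHom.op f t by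
    obtain ⟨t, ht⟩ := h
    exact ⟨t.unop, (congrArg MulOpposite.unop ht).symm⟩
  refine hr J ⟨?_, ?_⟩ (AddSubgroup.ne_bot_of_mem (a := MulOpposite.op a) key ?_)
    (MulOpposite.op x) ?_
  · intro t c hc y hy
    obtain ⟨s, hs⟩ := hc (f t.unop * y) (mul_mem (hf _) hy)
    exact ⟨s, by rw [← hs]; simp [mul_assoc]⟩
  · intro t c hc y hy
    obtain ⟨s, hs⟩ := hc y hy
    exact ⟨t.unop * s, by rw [map_mul, ← hs]; simp [mul_assoc]⟩
  · simpa using ha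
  · intro c hc
    obtain ⟨s, hs⟩ := hc x hx
    refine ⟨MulOpposite.op s, fun y hy => ?_, MulOpposite.unop_injective hs⟩
    obtain ⟨s', hs'⟩ := hc (x * y) (mul_mem hx hy)
    exact ⟨s', by rw [← hs', MulOpposite.unop_op, ← hs]; simp [mul_assoc]⟩

lemma IsGoldieQuotientRing.op {T Q : Type*} [Ring T] [Ring Q] {f : T →+* Q}
    (hf : IsGoldieQuotientRing f) : IsGoldieQuotientRing (RingHom.op f) where
  injective := fun x y hxy =>
    MulOpposite.unop_injective (hf.injective (MulOpposite.op_injective hxy))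
  isUnit_of_regular r hr := by
    have : IsRegular r.unop := by
      refine ⟨fun x y hxy => ?_, fun x y hxy => ?_⟩
      · exact MulOpposite.op_injective (hr.right (MulOpposite.unop_injective hxy))
      · exact MulOpposite.op_injective (hr.left (MulOpposite.unop_injective hxy))
    exact (hf.isUnit_of_regular _ this).op
  right_fraction x := by
    obtain ⟨a, s, hs, h⟩ := hf.left_fraction x.unop
    refine ⟨MulOpposite.op a, MulOpposite.op s, ?_, MulOpposite.unop_injective h⟩
    refine ⟨fun x y hxy => ?_, fun x y hxy => ?_⟩
    · exact MulOpposite.unop_injective (hs.right (MulOpposite.op_injective hxy))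
    · exact MulOpposite.unop_injective (hs.left (MulOpposite.op_injective hxy))
  left_fraction x := by
    obtain ⟨a, s, hs, h⟩ := hf.right_fraction x.unop
    refine ⟨MulOpposite.op a, MulOpposite.op s, ?_, MulOpposite.unop_injective h⟩
    refine ⟨fun x y hxy => ?_, fun x y hxy => ?_⟩
    · exact MulOpposite.unop_injective (hs.right (MulOpposite.op_injective hxy))
    · exact MulOpposite.unop_injective (hs.left (MulOpposite.op_injective hxy))

end MaximalOrder

namespace IsSkewGroupRing

variable {A G T : Type*} [Ring A] [Group G] [Fintype G] [MulSemiringAction G A] [Ring T]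
  {ι : A →+* T} {j : G → T} (H : IsSkewGroupRing A G T ι j)

/-- The coefficients of an element of a skew group ring. -/
noncomputable def coef (t : T) : G → A := (H.basis t).choose

lemma sum_coef (t : T) : ∑ g, ι (H.coef t g) * j g = t :=
  (H.basis t).choose_spec.1.symm

lemma coef_eq {t : T} {c : G → A} (h : t = ∑ g, ι (c g) * j g) : H.coef t = c :=
  (H.basis t).unique (H.sum_coef t).symm h

lemma coef_sum (c : G → A) : H.coef (∑ g, ι (c g) * j g) = c := H.coef_eq rfl

lemma ext {t t' : T} (h : ∀ g, H.coef t g = H.coef t' g) : t = t' := by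
  rw [← H.sum_coef t, ← H.sum_coef t', funext h]

lemma coef_add (t t' : T) (g : G) : H.coef (t + t') g = H.coef t g + H.coef t' g := by
  refine congrFun (H.coef_eq (c := fun g => H.coef t g + H.coef t' g) ?_) g
  simp [add_mul, Finset.sum_add_distrib, H.sum_coef]

/-- A single coefficient, as an additive homomorphism. -/
noncomputable def coefHom (g : G) : T →+ A := AddMonoidHom.mk' (fun t => H.coef t g)
  fun t t' => H.coef_add t t' g

lemma coef_zero (g : G) : H.coef 0 g = 0 := (H.coefHom g).map_zero

lemma coef_neg (t : T) (g : G) : H.coef (-t) g = -H.coef t g := (H.coefHom g).map_neg t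

lemma coef_sub (t t' : T) (g : G) : H.coef (t - t') g = H.coef t g - H.coef t' g :=
  (H.coefHom g).map_sub t t'

lemma coef_finset_sum {α : Type*} (s : Finset α) (t : α → T) (g : G) :
    H.coef (∑ i ∈ s, t i) g = ∑ i ∈ s, H.coef (t i) g := map_sum (H.coefHom g) t s

lemma coef_ι_mul (a : A) (t : T) (g : G) : H.coef (ι a * t) g = a * H.coef t g := by
  refine congrFun (H.coef_eq (c := fun g => a * H.coef t g) ?_) g
  simp [mul_assoc, ← Finset.mul_sum, H.sum_coef]

lemma coef_mul_j (t : T) (x g : G) : H.coef (t * j g) x = H.coef t (x * g⁻¹) := by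
  refine congrFun (H.coef_eq (c := fun x => H.coef t (x * g⁻¹)) ?_) x
  rw [← Equiv.sum_comp (Equiv.mulRight g)]
  simp [← H.j_mul, ← mul_assoc, ← Finset.sum_mul, H.sum_coef]

lemma coef_j_mul (t : T) (x g : G) : H.coef (j g * t) x = g • H.coef t (g⁻¹ * x) := by
  refine congrFun (H.coef_eq (c := fun x => g • H.coef t (g⁻¹ * x)) ?_) x
  rw [← Equiv.sum_comp (Equiv.mulLeft g)]
  conv_lhs => rw [← H.sum_coef t, Finset.mul_sum]
  simp [← H.j_mul, ← mul_assoc, H.comm]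

lemma coef_mul_ι (t : T) (a : A) (x : G) : H.coef (t * ι a) x = H.coef t x * (x • a) := by
  refine congrFun (H.coef_eq (c := fun x => H.coef t x * (x • a)) ?_) x
  conv_lhs => rw [← H.sum_coef t, Finset.sum_mul]
  simp [mul_assoc, H.comm]

lemma coef_one [DecidableEq G] (x : G) : H.coef 1 x = if x = 1 then 1 else 0 := by
  refine congrFun (H.coef_eq (c := fun x => if x = 1 then 1 else 0) ?_) x
  rw [Finset.sum_eq_single 1] <;> simp +contextual [H.j_one]

lemma coef_j [DecidableEq G] (g x : G) : H.coef (j g) x = if x = g then 1 else 0 := by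
  have := H.coef_mul_j 1 x g
  rw [one_mul, H.coef_one] at this
  simpa [mul_inv_eq_one] using this

lemma coef_ι [DecidableEq G] (a : A) (x : G) : H.coef (ι a) x = if x = 1 then a else 0 := by
  have := H.coef_ι_mul a 1 x
  rw [mul_one, H.coef_one] at this
  simpa using this

lemma coef_mul (t s : T) (x : G) :
    H.coef (t * s) x = ∑ g, H.coef t g * g • H.coef s (g⁻¹ * x) := by
  conv_lhs => rw [← H.sum_coef t, Finset.sum_mul, H.coef_finset_sum]
  simp [mul_assoc, H.coef_ι_mul, H.coef_j_mul]

include H in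
lemma j_pow (g : G) (i : ℕ) : j (g ^ i) = j g ^ i := by
  induction i with
  | zero => simp [H.j_one]
  | succ i ih => rw [pow_succ, pow_succ, ← H.j_mul, ih]

end IsSkewGroupRing

section Opposite

/-- The action on the opposite ring induced by an action on the ring. -/
abbrev opMulSemiringAction (G A : Type*) [Monoid G] [Ring A] [MulSemiringAction G A] :
    MulSemiringAction G Aᵐᵒᵖ :=
  { MulOpposite.instDistribMulAction, MulOpposite.instMulDistribMulAction with }

lemma IsSkewGroupRing.op {A G T : Type*} [Ring A] [Group G] [Fintype G] [MulSemiringAction G A]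
    [Ring T] {ι : A →+* T} {j : G → T} (H : IsSkewGroupRing A G T ι j) :
    letI := opMulSemiringAction G A
    IsSkewGroupRing Aᵐᵒᵖ G Tᵐᵒᵖ (RingHom.op ι) (fun g => MulOpposite.op (j g⁻¹)) := by
  let := opMulSemiringAction G A
  have hc : ∀ c : G → Aᵐᵒᵖ, (∑ g, RingHom.op ι (c g) * MulOpposite.op (j g⁻¹)).unop =
      ∑ g, ι (g • (c g⁻¹).unop) * j g := by
    intro c
    rw [← Equiv.sum_comp (Equiv.inv G)]
    simp [Finset.unop_sum, H.comm]
  refine ⟨fun x y hxy => ?_, ?_, ?_, ?_, ?_⟩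
  · exact MulOpposite.unop_injective (H.injective (MulOpposite.op_injective hxy))
  · simp [H.j_one]
  · intro g h
    rw [← MulOpposite.op_mul, H.j_mul, mul_inv_rev]
  · intro g a
    apply MulOpposite.unop_injective
    have : (g • a).unop = g • a.unop := rfl
    simp [H.comm, this]
  · intro t
    refine ⟨fun g => MulOpposite.op (g • H.coef t.unop g⁻¹), ?_, ?_⟩
    · apply MulOpposite.unop_injective
      simp only
      rw [hc]
      simp [H.sum_coef]
    · intro c h
      have h2 := congrArg MulOpposite.unop h
      rw [hc] at h2
      rw [H.coef_eq h2]
      ext g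
      simp

end Opposite

section TotalDegree

variable {k A : Type*} [Field k] [Ring A] [Algebra k A] {q p : k} {u v : A}

/-- The homogeneous elements of degree `d`. -/
def Homog (k : Type*) {A : Type*} [Field k] [Ring A] [Algebra k A] (u v : A) (d : ℕ) :
    Submodule k A :=
  Submodule.span k (mon u v '' {m | tdeg m = d})

/-- The elements of degree less than `d`. -/
def DegLT (k : Type*) {A : Type*} [Field k] [Ring A] [Algebra k A] (u v : A) (d : ℕ) :
    Submodule k A :=
  Submodule.span k (mon u v '' {m | tdeg m < d})

lemma tdeg_add (m m' : ℕ ×ₗ ℕ) : tdeg (m + m') = tdeg m + tdeg m' := by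
  simp only [tdeg, ofLex_add, Prod.fst_add, Prod.snd_add]
  omega

lemma mon_mem_Homog (m : ℕ ×ₗ ℕ) : mon u v m ∈ Homog k u v (tdeg m) :=
  Submodule.subset_span ⟨m, rfl, rfl⟩

lemma mon_mem_Homog_of_eq {m : ℕ ×ₗ ℕ} {d : ℕ} (h : tdeg m = d) : mon u v m ∈ Homog k u v d :=
  h ▸ mon_mem_Homog m

lemma Homog_le_DegLT {d e : ℕ} (h : d < e) : Homog k u v d ≤ DegLT k u v e := by
  refine Submodule.span_mono (Set.image_mono ?_)
  rintro m rfl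
  exact h

lemma DegLT_mono {d e : ℕ} (h : d ≤ e) : DegLT k u v d ≤ DegLT k u v e :=
  Submodule.span_mono (Set.image_mono fun _ hm => lt_of_lt_of_le hm h)

lemma u_mul_mem_Homog {d : ℕ} {a : A} (ha : a ∈ Homog k u v d) : u * a ∈ Homog k u v (d + 1) := by
  induction ha using Submodule.span_induction with
  | mem x hx =>
    obtain ⟨m, rfl, rfl⟩ := hx
    rw [u_mul_mon]
    exact mon_mem_Homog_of_eq (by rw [tdeg_add, add_comm]; rfl)
  | zero => simp
  | add x y _ _ hx hy => rw [mul_add]; exact add_mem hx hy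
  | smul c x _ hx => rw [mul_smul_comm]; exact Submodule.smul_mem _ _ hx

lemma v_mul_mem_Homog (rel : v * u = q • (u * v) + p • (u * u)) {d : ℕ} {a : A}
    (ha : a ∈ Homog k u v d) : v * a ∈ Homog k u v (d + 1) := by
  induction ha using Submodule.span_induction with
  | mem x hx =>
    obtain ⟨m, rfl, rfl⟩ := hx
    obtain ⟨c, hc⟩ := exists_v_mul_mon rel m
    rw [hc]
    refine add_mem (Submodule.smul_mem _ _ (mon_mem_Homog_of_eq ?_))
      (Submodule.smul_mem _ _ (mon_mem_Homog_of_eq ?_)) <;> rw [tdeg_add, add_comm] <;> rfl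
  | zero => simp
  | add x y _ _ hx hy => rw [mul_add]; exact add_mem hx hy
  | smul c x _ hx => rw [mul_smul_comm]; exact Submodule.smul_mem _ _ hx

lemma mul_mem_Homog (rel : v * u = q • (u * v) + p • (u * u)) {d e : ℕ} {a b : A}
    (ha : a ∈ Homog k u v d) (hb : b ∈ Homog k u v e) : a * b ∈ Homog k u v (d + e) := by
  induction ha using Submodule.span_induction with
  | mem x hx =>
    obtain ⟨m, rfl, rfl⟩ := hx
    have hv : ∀ i, v ^ i * b ∈ Homog k u v (e + i) := fun i => by
      induction i with
      | zero => simpa using hb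
      | succ i ih => rw [pow_succ', mul_assoc]; exact v_mul_mem_Homog rel ih
    have hu : ∀ i, u ^ i * (v ^ (ofLex m).1 * b) ∈ Homog k u v (e + (ofLex m).1 + i) := fun i => by
      induction i with
      | zero => simpa using hv _
      | succ i ih => rw [pow_succ', mul_assoc]; exact u_mul_mem_Homog ih
    have := hu (ofLex m).2
    rwa [← mul_assoc, add_assoc, add_comm] at this
  | zero => simp
  | add x y _ _ hx hy => rw [add_mul]; exact add_mem hx hy
  | smul c x _ hx => rw [smul_mul_assoc]; exact Submodule.smul_mem _ _ hx

lemma one_mem_Homog : (1 : A) ∈ Homog k u v 0 := by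
  simpa [mon] using mon_mem_Homog_of_eq (k := k) (u := u) (v := v) (m := 0) (d := 0) rfl

lemma u_mem_Homog : u ∈ Homog k u v 1 := by
  simpa using u_mul_mem_Homog (k := k) (u := u) (v := v) one_mem_Homog

lemma v_mem_Homog : v ∈ Homog k u v 1 := by
  simpa [mon] using mon_mem_Homog_of_eq (k := k) (u := u) (v := v) (m := toLex (1, 0)) (d := 1) rfl

lemma pow_mem_Homog (rel : v * u = q • (u * v) + p • (u * u)) {d : ℕ} {a : A}
    (ha : a ∈ Homog k u v d) (i : ℕ) : a ^ i ∈ Homog k u v (i * d) := by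
  induction i with
  | zero => simpa using one_mem_Homog
  | succ i ih => rw [pow_succ, add_mul, one_mul]; exact mul_mem_Homog rel ih ha

lemma mul_mem_DegLT (rel : v * u = q • (u * v) + p • (u * u)) {d e : ℕ} {a b : A}
    (ha : a ∈ DegLT k u v d) (hb : b ∈ DegLT k u v e) : a * b ∈ DegLT k u v (d + e) := by
  induction ha using Submodule.span_induction with
  | mem x hx =>
    obtain ⟨m, hm, rfl⟩ := hx
    induction hb using Submodule.span_induction with
    | mem x hx =>
      obtain ⟨m', hm', rfl⟩ := hx
      exact Homog_le_DegLT (add_lt_add hm hm')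
        (mul_mem_Homog rel (mon_mem_Homog m) (mon_mem_Homog m'))
    | zero => simp
    | add x y _ _ hx hy => rw [mul_add]; exact add_mem hx hy
    | smul c x _ hx => rw [mul_smul_comm]; exact Submodule.smul_mem _ _ hx
  | zero => simp
  | add x y _ _ hx hy => rw [add_mul]; exact add_mem hx hy
  | smul c x _ hx => rw [smul_mul_assoc]; exact Submodule.smul_mem _ _ hx

section Action

variable {G : Type*} [Monoid G] [MulSemiringAction G A] [SMulCommClass G k A] {g : G}

omit [SMulCommClass G k A] in
lemma smul_mon_mem_Homog (rel : v * u = q • (u * v) + p • (u * u)) (hu : g • u ∈ Homog k u v 1)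
    (hv : g • v ∈ Homog k u v 1) (m : ℕ ×ₗ ℕ) : g • mon u v m ∈ Homog k u v (tdeg m) := by
  rw [mon, smul_mul', smul_pow', smul_pow']
  have := mul_mem_Homog rel (pow_mem_Homog rel hu (ofLex m).2) (pow_mem_Homog rel hv (ofLex m).1)
  rwa [mul_one, mul_one, add_comm] at this

lemma smul_mem_Homog (rel : v * u = q • (u * v) + p • (u * u)) (hu : g • u ∈ Homog k u v 1)
    (hv : g • v ∈ Homog k u v 1) {d : ℕ} {a : A} (ha : a ∈ Homog k u v d) :
    g • a ∈ Homog k u v d := by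
  induction ha using Submodule.span_induction with
  | mem x hx =>
    obtain ⟨m, rfl, rfl⟩ := hx
    exact smul_mon_mem_Homog rel hu hv m
  | zero => simp
  | add x y _ _ hx hy => rw [smul_add]; exact add_mem hx hy
  | smul c x _ hx => rw [smul_comm]; exact Submodule.smul_mem _ _ hx

lemma smul_mem_DegLT (rel : v * u = q • (u * v) + p • (u * u)) (hu : g • u ∈ Homog k u v 1)
    (hv : g • v ∈ Homog k u v 1) {d : ℕ} {a : A} (ha : a ∈ DegLT k u v d) :
    g • a ∈ DegLT k u v d := by
  induction ha using Submodule.span_induction with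
  | mem x hx =>
    obtain ⟨m, hm, rfl⟩ := hx
    exact Homog_le_DegLT hm (smul_mon_mem_Homog rel hu hv m)
  | zero => simp
  | add x y _ _ hx hy => rw [smul_add]; exact add_mem hx hy
  | smul c x _ hx => rw [smul_comm]; exact Submodule.smul_mem _ _ hx

end Action

namespace IsPBW

variable (h : IsPBW q p u v)
include h

lemma mem_Homog_iff {a : A} {d : ℕ} :
    a ∈ Homog k u v d ↔ ∀ m, tdeg m ≠ d → h.basis.repr a m = 0 := by
  rw [Homog, ← h.coe_basis, h.basis.mem_span_image]
  exact ⟨fun H m hm => by_contra fun hne => hm (H (Finsupp.mem_support_iff.2 hne)),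
    fun H m hm => by_contra fun hne => Finsupp.mem_support_iff.1 hm (H m hne)⟩

lemma mem_DegLT_iff {a : A} {d : ℕ} :
    a ∈ DegLT k u v d ↔ ∀ m, d ≤ tdeg m → h.basis.repr a m = 0 := by
  rw [DegLT, ← h.coe_basis, h.basis.mem_span_image]
  exact ⟨fun H m hm => by_contra fun hne => hm.not_gt (H (Finsupp.mem_support_iff.2 hne)),
    fun H m hm => by_contra fun hne => Finsupp.mem_support_iff.1 hm (H m (not_lt.1 hne))⟩

lemma exists_mem_DegLT (a : A) : ∃ d, a ∈ DegLT k u v d := by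
  refine ⟨(h.basis.repr a).support.sup tdeg + 1, h.mem_DegLT_iff.2 fun m hm => ?_⟩
  by_contra hne
  have := Finset.le_sup (f := tdeg) (Finsupp.mem_support_iff.2 hne)
  omega

end IsPBW

/-- The indices of the monomials of degree less than `d`. -/
def lowMonomials (d : ℕ) : Finset (ℕ ×ₗ ℕ) :=
  ((Finset.range d).biUnion Finset.HasAntidiagonal.antidiagonal).map toLex.toEmbedding

lemma mem_lowMonomials {d : ℕ} {m : ℕ ×ₗ ℕ} : m ∈ lowMonomials d ↔ tdeg m < d := by
  simp [lowMonomials, tdeg, Finset.mem_map_equiv]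

lemma two_mul_card_lowMonomials (d : ℕ) : 2 * (lowMonomials d).card = d * (d + 1) := by
  rw [lowMonomials, Finset.card_map, Finset.card_biUnion]
  · simp only [Finset.Nat.card_antidiagonal]
    induction d with
    | zero => simp
    | succ d ih => rw [Finset.sum_range_succ, mul_add, ih]; ring
  · intro a _ b _ hab
    exact Finset.disjoint_left.2 fun x hx hx' =>
      hab ((Finset.HasAntidiagonal.mem_antidiagonal.1 hx).symm.trans (Finset.HasAntidiagonal.mem_antidiagonal.1 hx'))

lemma exists_card_lowMonomials_lt (N D : ℕ) :
    ∃ d, (lowMonomials (d + D)).card * N < (lowMonomials d).card * (N + 1) := by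
  refine ⟨N * (D ^ 2 + 3 * D) + 1, ?_⟩
  have h1 := two_mul_card_lowMonomials (N * (D ^ 2 + 3 * D) + 1 + D)
  have h2 := two_mul_card_lowMonomials (N * (D ^ 2 + 3 * D) + 1)
  generalize hd : N * (D ^ 2 + 3 * D) + 1 = d at *
  have h3 : (d + D) * (d + D + 1) * N < d * (d + 1) * (N + 1) := by
    have h4 : 1 ≤ d := by omega
    have h5 : N * (D ^ 2 + D) ≤ N * (D ^ 2 + D) * d := Nat.le_mul_of_pos_right _ h4
    have h6 : d * d = (N * (D ^ 2 + 3 * D) + 1) * d := by rw [hd]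
    nlinarith
  rw [← h1, ← h2] at h3
  nlinarith

end TotalDegree

section Denominators

variable {k A G T : Type*} [Field k] [Ring A] [Algebra k A] [Group G] [Fintype G]
  [MulSemiringAction G A] [SMulCommClass G k A] [Ring T] {ι : A →+* T} {j : G → T}
  {q p : k} {u v : A}

/-- Every regular element of the skew group ring divides a nonzero element of `A`. -/
lemma exists_mul_eq_ι (H : IsSkewGroupRing A G T ι j) (h : IsPBW q p u v)
    (hG : ∀ g : G, g • u ∈ Homog k u v 1 ∧ g • v ∈ Homog k u v 1) {s : T} (hs : IsRegular s) :
    ∃ t : T, ∃ z : A, z ≠ 0 ∧ t * s = ι z := by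
  classical
  obtain ⟨D, hD⟩ : ∃ D, ∀ g, H.coef s g ∈ DegLT k u v D := by
    choose D hD using fun g => h.exists_mem_DegLT (H.coef s g)
    exact ⟨Finset.univ.sup D, fun g => DegLT_mono (Finset.le_sup (Finset.mem_univ g)) (hD g)⟩
  obtain ⟨d, hd⟩ := exists_card_lowMonomials_lt (Fintype.card G - 1) D
  let ψ : (lowMonomials d × G → k) →ₗ[k] (G → A) := Fintype.linearCombination k
    fun x y => mon u v x.1 * x.2 • H.coef s (x.2⁻¹ * y)
  let φ : (lowMonomials d × G → k) →ₗ[k] (lowMonomials (d + D) × {y : G // y ≠ 1} → k) :=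
    LinearMap.pi fun x => (Finsupp.lapply x.1.1).comp
      (h.basis.repr.toLinearMap.comp ((LinearMap.proj x.2.1).comp ψ))
  have hψ : ∀ c y, ψ c y = ∑ x, c x • (mon u v x.1 * x.2 • H.coef s (x.2⁻¹ * y)) := by
    intro c y
    simp [ψ, Fintype.linearCombination_apply]
  have hker : LinearMap.ker φ ≠ ⊥ := by
    apply LinearMap.ker_ne_bot_of_finrank_lt
    have hc : Fintype.card {y : G // y ≠ 1} = Fintype.card G - 1 := by
      simp [Fintype.card_subtype_compl]
    have hp : Fintype.card G - 1 + 1 = Fintype.card G := Nat.succ_pred_eq_of_pos Fintype.card_pos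
    rw [hp] at hd
    simpa [hc] using hd
  obtain ⟨c, hc, hc0⟩ := Submodule.exists_mem_ne_zero_of_ne_bot hker
  let t : T := ∑ g, ι (∑ m, c (m, g) • mon u v m.1) * j g
  have ht : ∀ g, H.coef t g = ∑ m, c (m, g) • mon u v m.1 := fun g => congrFun (H.coef_sum _) g
  have hts : ∀ y, H.coef (t * s) y = ψ c y := by
    intro y
    rw [H.coef_mul, hψ, Fintype.sum_prod_type, Finset.sum_comm]
    refine Finset.sum_congr rfl fun g _ => ?_
    rw [ht, Finset.sum_mul]
    simp only [smul_mul_assoc]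
  have ht0 : t ≠ 0 := by
    intro h0
    apply hc0
    ext ⟨m, g⟩
    have h1 := ht g
    rw [h0, H.coef_zero] at h1
    have h2 := linearIndependent_iff'.1 (h.linearIndependent.comp (Subtype.val : lowMonomials d → _)
      Subtype.val_injective) Finset.univ (fun m => c (m, g)) h1.symm m (Finset.mem_univ _)
    exact h2
  have hy : ∀ y, y ≠ 1 → H.coef (t * s) y = 0 := by
    intro y hy
    have hlt : H.coef (t * s) y ∈ DegLT k u v (d + D) := by
      rw [hts, hψ]
      refine Submodule.sum_mem _ fun x _ => Submodule.smul_mem _ _ (mul_mem_DegLT h.rel ?_ ?_)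
      · exact Homog_le_DegLT (mem_lowMonomials.1 x.1.2) (mon_mem_Homog _)
      · exact smul_mem_DegLT h.rel (hG _).1 (hG _).2 (hD _)
    apply h.basis.repr.injective
    ext m
    by_cases hm : tdeg m < d + D
    · have := congrFun (LinearMap.mem_ker.1 hc) (⟨m, mem_lowMonomials.2 hm⟩, ⟨y, hy⟩)
      simpa [φ, hts] using this
    · simpa using h.mem_DegLT_iff.1 hlt m (not_lt.1 hm)
  have hι : t * s = ι (H.coef (t * s) 1) := by
    refine H.ext fun y => ?_
    rw [H.coef_ι]
    split_ifs with h1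
    · rw [h1]
    · exact hy y h1
  refine ⟨t, _, fun h0 => ht0 ?_, hι⟩
  rw [h0, map_zero] at hι
  exact hs.right (by simpa using hι)

omit [SMulCommClass G k A] in
lemma isRegular_ι (H : IsSkewGroupRing A G T ι j) (h : IsPBW q p u v) {z : A} (hz : z ≠ 0) :
    IsRegular (ι z) := by
  constructor
  · intro x y hxy
    refine H.ext fun g => sub_eq_zero.1 (h.eq_zero_of_mul_eq_zero hz ?_)
    have := congrArg (fun t => H.coef t g) hxy
    simpa [H.coef_ι_mul, mul_sub, sub_eq_zero] using this
  · intro x y hxy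
    refine H.ext fun g => sub_eq_zero.1 ?_
    have := congrArg (fun t => H.coef t g) hxy
    simp only [H.coef_mul_ι, ← sub_eq_zero (b := H.coef y g * _), ← sub_mul] at this
    by_contra hne
    exact h.mul_ne_zero hne ((smul_ne_zero_iff_ne g).2 hz) this

/-- Elements of the quotient ring have denominators in `A`. -/
lemma exists_denominator (H : IsSkewGroupRing A G T ι j) (h : IsPBW q p u v)
    (hG : ∀ g : G, g • u ∈ Homog k u v 1 ∧ g • v ∈ Homog k u v 1) {Q : Type*} [Ring Q]
    {f : T →+* Q} (hf : IsGoldieQuotientRing f) (x : Q) :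
    ∃ z : A, z ≠ 0 ∧ ∃ a : T, f (ι z) * x = f a := by
  obtain ⟨a, s, hs, hx⟩ := hf.left_fraction x
  obtain ⟨t, z, hz, hts⟩ := exists_mul_eq_ι H h hG hs
  exact ⟨z, hz, t * a, by rw [← hts, map_mul, map_mul, mul_assoc, hx]⟩

end Denominators

section Projection

variable {k T : Type*} [Field k] [Ring T] [Algebra k T] {n : ℕ} {γ : T} {ζ ω : k}

/-- Up to the factor `n`, the projection onto the `ζ`-eigenspace of an element `γ` with
`γ ^ n = 1`. -/
def eigenProj (n : ℕ) (γ : T) (ζ : k) : T := ∑ i ∈ Finset.range n, (ζ⁻¹) ^ i • γ ^ i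

lemma mul_eigenProj (hγ : γ ^ n = 1) (hζ : ζ ^ n = 1) (hn : 0 < n) :
    γ * eigenProj n γ ζ = ζ • eigenProj n γ ζ := by
  have h0 : ζ ≠ 0 := by
    rintro rfl
    simp [hn.ne'] at hζ
  have h1 := Finset.sum_range_succ (fun i => (ζ⁻¹) ^ i • γ ^ i) n
  rw [Finset.sum_range_succ', hγ, inv_pow ζ n, hζ, inv_one, pow_zero, pow_zero, one_smul,
    add_left_inj] at h1
  unfold eigenProj
  conv_rhs => rw [← h1]
  rw [Finset.mul_sum, Finset.smul_sum]
  refine Finset.sum_congr rfl fun i _ => ?_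
  rw [mul_smul_comm, ← pow_succ', smul_smul, pow_succ' ζ⁻¹, mul_inv_cancel_left₀ h0]

lemma eigenProj_mul (hγ : γ ^ n = 1) (hζ : ζ ^ n = 1) (hn : 0 < n) :
    eigenProj n γ ζ * γ = ζ • eigenProj n γ ζ := by
  rw [← mul_eigenProj hγ hζ hn, eigenProj, Finset.mul_sum, Finset.sum_mul]
  exact Finset.sum_congr rfl fun i _ => by rw [smul_mul_assoc, mul_smul_comm, ← pow_succ, pow_succ']

lemma sum_eigenProj (hω : IsPrimitiveRoot ω n) (hn : 0 < n) :
    ∑ c ∈ Finset.range n, eigenProj n γ (ω ^ c) = algebraMap k T n := by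
  simp only [eigenProj]
  rw [Finset.sum_comm, Finset.sum_eq_single 0]
  · simp
  · intro i hi hi0
    rw [← Finset.sum_smul]
    convert zero_smul k (γ ^ i)
    have h1 : (ω⁻¹ ^ i) ≠ 1 := hω.inv.pow_ne_one_of_pos_of_lt hi0 (Finset.mem_range.1 hi)
    have h2 := mul_neg_geom_sum (ω⁻¹ ^ i) n
    rw [pow_right_comm, hω.inv.pow_eq_one, one_pow, sub_self, mul_eq_zero] at h2
    rw [← h2.resolve_left (sub_ne_zero.2 h1.symm)]
    refine Finset.sum_congr rfl fun c _ => ?_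
    rw [← inv_pow, pow_right_comm]
  · intro h
    exact absurd (Finset.mem_range.2 hn) h

end Projection

section Cyclic

/-- The action of a cyclic group of order `n` generated by `g`, scaling `u` by `ω` and `v`
by `ω⁻¹`. -/
structure IsDiagonalAction {k A C : Type*} [Field k] [Ring A] [Algebra k A] [Group C]
    [MulSemiringAction C A] (n : ℕ) (ω : k) (g : C) (u v : A) : Prop where
  pos : 0 < n
  prim : IsPrimitiveRoot ω n
  order : orderOf g = n
  generates : ∀ x : C, ∃ i : ℕ, x = g ^ i
  smul_u : g • u = ω • u
  smul_v : g • v = ω⁻¹ • v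

variable {k A C T : Type*} [Field k] [Ring A] [Algebra k A] [Group C] [Fintype C]
  [MulSemiringAction C A] [SMulCommClass C k A] [Ring T] [Algebra k T] {ι : A →+* T} {j : C → T}
  {q p : k} {u v : A} {n : ℕ} {ω : k} {g : C}

/-- The eigenvalue of the generator on a monomial. -/
def weight (ω : k) (m : ℕ ×ₗ ℕ) : k := ω ^ (ofLex m).2 * (ω⁻¹) ^ (ofLex m).1

lemma weight_add (ω : k) (m m' : ℕ ×ₗ ℕ) : weight ω (m + m') = weight ω m * weight ω m' := by
  simp only [weight, ofLex_add, Prod.fst_add, Prod.snd_add, pow_add]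
  ring

lemma weight_nsmul (ω : k) (t : ℕ) (m : ℕ ×ₗ ℕ) : weight ω (t • m) = weight ω m ^ t := by
  induction t with
  | zero => simp [weight]
  | succ t ih => rw [succ_nsmul, weight_add, ih, pow_succ]

lemma weight_pow_eq_one (hω : ω ^ n = 1) (m : ℕ ×ₗ ℕ) : weight ω m ^ n = 1 := by
  rw [weight, mul_pow, pow_right_comm, hω, pow_right_comm, inv_pow, hω]
  simp

namespace IsDiagonalAction

variable (D : IsDiagonalAction n ω g u v)
include D

omit [Fintype C] in
lemma repr_smul (h : IsPBW q p u v) (i : ℕ) (a : A) (m : ℕ ×ₗ ℕ) :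
    h.basis.repr (g ^ i • a) m = weight ω m ^ i * h.basis.repr a m := by
  induction i generalizing a with
  | zero => simp
  | succ i ih =>
    rw [pow_succ, mul_smul, ih, pow_succ, mul_assoc]
    congr 1
    have h1 : (Finsupp.lapply m ∘ₗ h.basis.repr.toLinearMap) ∘ₗ
        (DistribSMul.toLinearMap k A g) = weight ω m •
          (Finsupp.lapply m ∘ₗ h.basis.repr.toLinearMap) := by
      refine h.basis.ext fun m' => ?_
      have h2 : g • mon u v m' = weight ω m' • mon u v m' := by
        rw [mon, smul_mul', smul_pow', smul_pow', D.smul_u, D.smul_v, smul_pow, smul_pow,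
          smul_mul_smul_comm, weight]
      simp only [LinearMap.comp_apply, h.basis_apply, DistribSMul.toLinearMap_apply, h2]
      simp only [map_smul, LinearMap.smul_apply]
      simp only [LinearEquiv.coe_coe, Finsupp.lapply_apply, h.repr_mon, LinearMap.comp_apply]
      split_ifs with h3
      · rw [h3]
      · simp
    simpa using LinearMap.congr_fun h1 a

variable (H : IsSkewGroupRing A C T ι j) (hι : ∀ (c : k) (a : A), ι (c • a) = c • ι a)
include H hι

omit D [SMulCommClass C k A] in
lemma coef_smul (c : k) (t : T) (x : C) : H.coef (c • t) x = c • H.coef t x := by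
  have : c • t = ι (c • 1) * t := by rw [hι, map_one, smul_one_mul]
  rw [this, H.coef_ι_mul, smul_one_mul]

omit hι [SMulCommClass C k A] [Algebra k T] in
lemma j_pow_eq_one : j g ^ n = 1 := by
  rw [← H.j_pow, ← D.order, pow_orderOf_eq_one, H.j_one]

omit D [SMulCommClass C k A] in
/-- The coefficients of an eigenvector of right multiplication by the generator. -/
lemma coef_pow {t : T} {ζ : k} (ht : t * j g = ζ • t) (i : ℕ) :
    H.coef t 1 = ζ ^ i • H.coef t (g ^ i) := by
  induction i with
  | zero => simp
  | succ i ih =>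
    have := H.coef_mul_j t (g ^ (i + 1)) g
    rw [ht, coef_smul H hι, pow_succ, mul_inv_cancel_right, ← pow_succ] at this
    rw [ih, ← this, smul_smul, ← pow_succ]

omit [SMulCommClass C k A] in
lemma eq_zero_of_coef_one {t : T} {ζ : k} (hζ : ζ ≠ 0) (ht : t * j g = ζ • t)
    (h1 : H.coef t 1 = 0) : t = 0 := by
  refine H.ext fun x => ?_
  obtain ⟨i, rfl⟩ := D.generates x
  have := coef_pow H hι ht i
  rw [h1, eq_comm, smul_eq_zero_iff_right (pow_ne_zero i hζ)] at this
  rw [this, H.coef_zero]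

omit [SMulCommClass C k A] in
lemma mul_eigenvector {a b : T} {ζ : k} (ha : a * j g = ζ • a)
    (hb : j g * b = ζ • b) : a * b = (Fintype.card C : k) • (ι (H.coef a 1) * b) := by
  have hpow : ∀ i, j g ^ i * b = ζ ^ i • b := fun i => by
    induction i with
    | zero => simp
    | succ i ih => rw [pow_succ, mul_assoc, hb, mul_smul_comm, ih, smul_smul, pow_succ']
  conv_lhs => rw [← H.sum_coef a, Finset.sum_mul]
  rw [Finset.sum_eq_card_nsmul (b := ι (H.coef a 1) * b), Finset.card_univ, Nat.cast_smul_eq_nsmul]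
  intro x _
  obtain ⟨i, rfl⟩ := D.generates x
  rw [coef_pow H hι ha i, H.j_pow, mul_assoc, hpow, hι, smul_mul_assoc, mul_smul_comm]

/-- The key inequality between degrees of leading monomials, for one of the two degrees `π`. -/
lemma le_of_stable [CharZero k] (h : IsPBW q p u v) {Q : Type*} [Ring Q] {f : T →+* Q}
    (hf : Function.Injective f) {J : AddSubgroup T} (hJ : IsTwoSided J) (hJ0 : J ≠ ⊥)
    {z : A} {x : Q} {a : T} (hza : f (ι z) * x = f a) (hx : ∀ b ∈ J, ∃ c ∈ J, x * f b = f c)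
    {ζ : k} (hζ : ζ ^ n = 1) (ha : a * j g = ζ • a) (π : ℕ ×ₗ ℕ →+ ℕ) {w : ℕ ×ₗ ℕ}
    (hπ : π w = 0) (hw : IsPrimitiveRoot (weight ω w) n) {mz ma : ℕ ×ₗ ℕ}
    (hmz : IsLead k u v z mz) (hma : IsLead k u v (H.coef a 1) ma) : π mz ≤ π ma := by
  classical
  have hne : ∀ {ξ : k}, ξ ^ n = 1 → ξ ≠ 0 := by
    rintro ξ hξ rfl
    simp [D.pos.ne'] at hξ
  have : NeZero n := ⟨D.pos.ne'⟩
  have hγ := D.j_pow_eq_one H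
  have hJk : ∀ (c : k), ∀ b ∈ J, c • b ∈ J := fun c b hb => by
    rw [← smul_one_mul]
    exact hJ.mul_left _ _ hb
  have hcard : (Fintype.card C : k) ≠ 0 := by simp
  have hn : (n : k) ≠ 0 := by simp [D.pos.ne']
  obtain ⟨ξ, hξ, b0, hb0, hb0J, hb0ξ⟩ : ∃ ξ : k, ξ ^ n = 1 ∧ ∃ b : T, b ≠ 0 ∧ b ∈ J ∧
      b * j g = ξ • b := by
    obtain ⟨⟨b, hb⟩, hb0⟩ := AddSubgroup.ne_bot_iff_exists_ne_zero.1 hJ0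
    by_contra! hno
    refine hb0 (Subtype.ext ?_)
    have h1 : b * algebraMap k T n = 0 := by
      rw [← sum_eigenProj (γ := j g) D.prim D.pos, Finset.mul_sum]
      refine Finset.sum_eq_zero fun c _ => ?_
      have hc : (ω ^ c) ^ n = 1 := by rw [pow_right_comm, D.prim.pow_eq_one, one_pow]
      by_contra h0
      refine hno _ hc _ h0 (hJ.mul_right _ _ hb) ?_
      rw [mul_assoc, eigenProj_mul hγ hc D.pos, mul_smul_comm]
    rw [← Algebra.commutes, ← Algebra.smul_def] at h1
    calc b = (n : k)⁻¹ • (n : k) • b := by rw [smul_smul, inv_mul_cancel₀ hn, one_smul]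
      _ = 0 := by rw [h1, smul_zero]
  obtain ⟨b, m, hb0, hbJ, hbξ, hm, hmin⟩ : ∃ b m, b ≠ 0 ∧ b ∈ J ∧ b * j g = ξ • b ∧
      IsLead k u v (H.coef b 1) m ∧ ∀ b' m', b' ≠ 0 → b' ∈ J → b' * j g = ξ • b' → 
        IsLead k u v (H.coef b' 1) m' → π m ≤ π m' := by
    have hex : ∃ d, ∃ b m, b ≠ 0 ∧ b ∈ J ∧ b * j g = ξ • b ∧ IsLead k u v (H.coef b 1) m ∧
        π m = d := by
      obtain ⟨m, hm⟩ := h.exists_isLead (a := H.coef b0 1) fun h0 =>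
        hb0 (D.eq_zero_of_coef_one H hι (hne hξ) hb0ξ h0)
      exact ⟨_, b0, m, hb0, hb0J, hb0ξ, hm, rfl⟩
    obtain ⟨b, m, h1, h2, h3, h4, h5⟩ := Nat.find_spec hex
    refine ⟨b, m, h1, h2, h3, h4, fun b' m' h1' h2' h3' h4' => ?_⟩
    rw [h5]
    exact Nat.find_min' hex ⟨b', m', h1', h2', h3', h4', rfl⟩
  obtain ⟨t, -, ht⟩ := hw.eq_pow_of_pow_eq_one (ξ := ζ * ξ⁻¹ * (weight ω m)⁻¹) (by
    rw [mul_pow, mul_pow, inv_pow, inv_pow, hζ, hξ, weight_pow_eq_one D.prim.pow_eq_one]; simp)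
  have hwt : ζ⁻¹ * ξ * weight ω (t • w + m) = 1 := by
    have := hne (weight_pow_eq_one D.prim.pow_eq_one m)
    have := hne hξ
    have := hne hζ
    rw [weight_add, weight_nsmul, ht]
    field_simp
  set c : T := eigenProj n (j g) ζ * (ι (mon u v (t • w)) * b) with hc
  have hcJ : c ∈ J := hJ.mul_left _ _ (hJ.mul_left _ _ hbJ)
  have hcζ : j g * c = ζ • c := by
    rw [hc, ← mul_assoc, mul_eigenProj hγ hζ D.pos, smul_mul_assoc]
  have hcξ : c * j g = ξ • c := by
    rw [hc, mul_assoc, mul_assoc, hbξ, mul_smul_comm, mul_smul_comm]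
  have hcoef : H.coef c 1 = ∑ i ∈ Finset.range n, (ζ⁻¹ * ξ) ^ i •
      (g ^ i • (mon u v (t • w) * H.coef b 1)) := by
    rw [hc, eigenProj, Finset.sum_mul, H.coef_finset_sum]
    refine Finset.sum_congr rfl fun i _ => ?_
    have h1 : H.coef b ((g ^ i)⁻¹) = ξ ^ i • H.coef b 1 := by
      have h2 : ∀ i, b * j g ^ i = ξ ^ i • b := fun i => by
        induction i with
        | zero => simp
        | succ i ih => rw [pow_succ, ← mul_assoc, ih, smul_mul_assoc, hbξ, smul_smul, ← pow_succ]
      have h3 := H.coef_mul_j b 1 (g ^ i)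
      rwa [H.j_pow, h2, coef_smul H hι, one_mul, eq_comm] at h3
    rw [smul_mul_assoc, coef_smul H hι, ← H.j_pow, H.coef_j_mul, H.coef_ι_mul, mul_one, h1,
      mul_smul_comm, smul_comm (g ^ i), smul_smul, mul_pow]
  have hlead : IsLead k u v (H.coef c 1) (t • w + m) := by
    have h1 : ∀ m', h.basis.repr (H.coef c 1) m' = (∑ i ∈ Finset.range n,
        (ζ⁻¹ * ξ * weight ω m') ^ i) * h.basis.repr (mon u v (t • w) * H.coef b 1) m' := by
      intro m'
      rw [hcoef, map_sum, Finsupp.finsetSum_apply, Finset.sum_mul]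
      refine Finset.sum_congr rfl fun i _ => ?_
      rw [map_smul, Finsupp.smul_apply, D.repr_smul h, mul_pow _ (weight ω m'), smul_eq_mul,
        mul_assoc]
    have h2 := h.isLead_iff.1 (mon_mul_lead h.q_ne h.rel (t • w) hm)
    refine h.isLead_iff.2 ⟨?_, fun m' hm' => ?_⟩
    · rw [h1, hwt]
      simpa [hn] using h2.1
    · rw [h1, h2.2 m' hm', mul_zero]
  obtain ⟨d, hdJ, hd⟩ := hx c hcJ
  have hzd : ι z * d = a * c := hf (by rw [map_mul, map_mul, ← hd, ← mul_assoc, hza])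
  have hdξ : d * j g = ξ • d := by
    apply hf
    rw [map_mul, ← hd, mul_assoc, ← map_mul, hcξ, Algebra.smul_def, Algebra.commutes, map_mul,
      ← mul_assoc, hd, ← map_mul, ← Algebra.commutes, ← Algebra.smul_def]
  have hlead2 : IsLead k u v (z * H.coef d 1) (ma + (t • w + m)) := by
    rw [← H.coef_ι_mul, hzd, D.mul_eigenvector H hι ha hcζ, coef_smul H hι, H.coef_ι_mul]
    exact (hma.mul h.q_ne h.rel hlead).smul hcard
  have hd0 : H.coef d 1 ≠ 0 := by
    intro h0
    rw [h0, mul_zero] at hlead2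
    exact h.isLead_ne_zero hlead2 rfl
  obtain ⟨m', hm'⟩ := h.exists_isLead hd0
  have h3 := h.isLead_unique (hmz.mul h.q_ne h.rel hm') hlead2
  have h4 := hmin d m' (by rintro rfl; exact hd0 (H.coef_zero 1)) hdJ hdξ hm'
  have h5 := congrArg π h3
  simp only [map_add, map_nsmul, hπ, smul_zero, zero_add] at h5
  omega

omit [SMulCommClass C k A] in
lemma coef_eigenProj_one (ζ : k) : H.coef (eigenProj n (j g) ζ) 1 = 1 := by
  classical
  rw [eigenProj, H.coef_finset_sum, Finset.sum_eq_single 0]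
  · simp [H.coef_one]
  · intro i hi hi0
    rw [coef_smul H hι, ← H.j_pow, H.coef_j, if_neg, smul_zero]
    intro h1
    have := orderOf_dvd_of_pow_eq_one h1.symm
    rw [D.order] at this
    exact absurd (Nat.le_of_dvd (Nat.pos_of_ne_zero hi0) this)
      (not_le.2 (Finset.mem_range.1 hi))
  · intro h
    exact absurd (Finset.mem_range.2 D.pos) h

/-- The case of an element that is an eigenvector for right multiplication by the generator. -/
lemma mem_range_of_eigenvector [CharZero k] (h : IsPBW q p u v) {Q : Type*} [Ring Q] {f : T →+* Q}
    (hf : Function.Injective f) {J : AddSubgroup T} (hJ : IsTwoSided J) (hJ0 : J ≠ ⊥)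
    {z : A} (hz0 : z ≠ 0) (hz : ∀ y, f (ι z) * y = 0 → y = 0) {ζ : k} (hζ : ζ ^ n = 1)
    {x : Q} {a : T} (hza : f (ι z) * x = f a) (hx : ∀ b ∈ J, ∃ c ∈ J, x * f b = f c)
    (ha : a * j g = ζ • a) : ∃ t, x = f t := by
  obtain ⟨mz, hmz⟩ := h.exists_isLead hz0
  have hζ0 : ζ ≠ 0 := by
    rintro rfl
    simp [D.pos.ne'] at hζ
  by_cases h1 : H.coef a 1 = 0
  · have h2 := D.eq_zero_of_coef_one H hι hζ0 ha h1
    exact ⟨0, by rw [map_zero]; exact hz x (by rw [hza, h2, map_zero])⟩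
  obtain ⟨ma, hma⟩ := h.exists_isLead h1
  induction ma using WellFoundedLT.induction generalizing x a with
  | ind ma ih =>
  have hu : (ofLex mz).1 ≤ (ofLex ma).1 := D.le_of_stable H hι h hf hJ hJ0 hza hx hζ ha
    (π := ⟨⟨fun m => (ofLex m).1, rfl⟩, fun _ _ => rfl⟩) (w := toLex (0, 1)) rfl
    (by simpa [weight] using D.prim) hmz hma
  have hv : (ofLex mz).2 ≤ (ofLex ma).2 := D.le_of_stable H hι h hf hJ hJ0 hza hx hζ ha
    (π := ⟨⟨fun m => (ofLex m).2, rfl⟩, fun _ _ => rfl⟩) (w := toLex (1, 0)) rfl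
    (by simpa [weight] using D.prim.inv) hmz hma
  obtain ⟨μ, rfl⟩ : ∃ μ, ma = mz + μ := by
    refine ⟨toLex ((ofLex ma).1 - (ofLex mz).1, (ofLex ma).2 - (ofLex mz).2), ?_⟩
    apply ofLex.injective
    ext
    · simp [hu]
    · simp [hv]
  obtain ⟨c, hc, hc'⟩ := hma
  obtain ⟨d, hd, hd'⟩ := hmz.mul h.q_ne h.rel (isLead_mon μ)
  let s : T := ι ((c * d⁻¹) • mon u v μ) * eigenProj n (j g) ζ
  have hs : H.coef s 1 = (c * d⁻¹) • mon u v μ := by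
    rw [H.coef_ι_mul, D.coef_eigenProj_one H hι, mul_one]
  have hza' : f (ι z) * (x - f s) = f (a - ι z * s) := by
    rw [mul_sub, hza, map_sub, map_mul f (ι z) s]
  have hx' : ∀ b ∈ J, ∃ c ∈ J, (x - f s) * f b = f c := by
    intro b hb
    obtain ⟨e, he, hxe⟩ := hx b hb
    exact ⟨e - s * b, sub_mem he (hJ.mul_left _ _ hb), by rw [sub_mul, hxe, map_sub, map_mul f s b]⟩
  have ha' : (a - ι z * s) * j g = ζ • (a - ι z * s) := by
    rw [sub_mul, ha, smul_sub, mul_assoc, mul_assoc, eigenProj_mul (D.j_pow_eq_one H) hζ D.pos,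
      mul_smul_comm, mul_smul_comm]
  have hlow : H.coef (a - ι z * s) 1 ∈ Below k u v (mz + μ) := by
    have h3 := sub_mem hc' (Submodule.smul_mem _ (c * d⁻¹) hd')
    rw [smul_sub, smul_smul, inv_mul_cancel_right₀ hd] at h3
    rw [H.coef_sub, H.coef_ι_mul, hs, mul_smul_comm]
    convert h3 using 1
    abel
  suffices h3 : ∃ t, x - f s = f t by
    obtain ⟨t, ht⟩ := h3
    exact ⟨t + s, by rw [map_add, ← ht, sub_add_cancel]⟩
  by_cases h1' : H.coef (a - ι z * s) 1 = 0
  · have h2 := D.eq_zero_of_coef_one H hι hζ0 ha' h1'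
    exact ⟨0, by rw [map_zero]; exact hz _ (by rw [hza', h2, map_zero])⟩
  obtain ⟨m', hm'⟩ := h.exists_isLead h1'
  refine ih m' ?_ hza' hx' ha' h1' hm'
  by_contra hle
  exact (h.isLead_iff.1 hm').1 (h.mem_Below_iff.1 hlow m' (not_lt.1 hle))

theorem mem_range_of_stable [CharZero k] (h : IsPBW q p u v) {Q : Type*} [Ring Q] {f : T →+* Q}
    (hf : Function.Injective f) {J : AddSubgroup T} (hJ : IsTwoSided J) (hJ0 : J ≠ ⊥)
    {z : A} (hz0 : z ≠ 0) (hz : ∀ y, f (ι z) * y = 0 → y = 0)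
    {x : Q} {a : T} (hza : f (ι z) * x = f a) (hx : ∀ b ∈ J, ∃ c ∈ J, x * f b = f c) :
    ∃ t, x = f t := by
  have key : ∀ c, ∃ t, x * f (eigenProj n (j g) (ω ^ c)) = f t := by
    intro c
    have hc : (ω ^ c) ^ n = 1 := by rw [pow_right_comm, D.prim.pow_eq_one, one_pow]
    refine D.mem_range_of_eigenvector H hι h hf hJ hJ0 hz0 hz hc
      (a := a * eigenProj n (j g) (ω ^ c)) ?_ ?_ ?_
    · rw [← mul_assoc, hza, map_mul]
    · intro b hb
      obtain ⟨d, hd, hxd⟩ := hx _ (hJ.mul_left (eigenProj n (j g) (ω ^ c)) b hb)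
      exact ⟨d, hd, by rw [mul_assoc, ← map_mul, hxd]⟩
    · rw [mul_assoc, eigenProj_mul (D.j_pow_eq_one H) hc D.pos, mul_smul_comm]
  choose t ht using key
  have hn : (n : k) ≠ 0 := by simp [D.pos.ne']
  refine ⟨(∑ c ∈ Finset.range n, t c) * algebraMap k T (n : k)⁻¹, ?_⟩
  rw [map_mul, map_sum, ← Finset.sum_congr rfl fun c _ => ht c, ← Finset.mul_sum, ← map_sum,
    sum_eigenProj D.prim D.pos, mul_assoc, ← map_mul, ← map_mul, mul_inv_cancel₀ hn, map_one,
    map_one, mul_one]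

end IsDiagonalAction

end Cyclic

section Symbols

variable {k A : Type*} [Field k] [Ring A] [Algebra k A] {q p : k} {u v : A}

lemma Homog_mul_mem_DegLT (rel : v * u = q • (u * v) + p • (u * u)) {d e : ℕ} {a b : A}
    (ha : a ∈ Homog k u v d) (hb : b ∈ DegLT k u v e) : a * b ∈ DegLT k u v (d + e) := by
  induction hb using Submodule.span_induction with
  | mem x hx =>
    obtain ⟨m, hm, rfl⟩ := hx
    exact Homog_le_DegLT (Nat.add_lt_add_left hm d) (mul_mem_Homog rel ha (mon_mem_Homog m))
  | zero => simp
  | add x y _ _ hx hy => rw [mul_add]; exact add_mem hx hy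
  | smul c x _ hx => rw [mul_smul_comm]; exact Submodule.smul_mem _ _ hx

lemma DegLT_mul_mem_DegLT (rel : v * u = q • (u * v) + p • (u * u)) {d e : ℕ} {a b : A}
    (ha : a ∈ DegLT k u v d) (hb : b ∈ Homog k u v e) : a * b ∈ DegLT k u v (d + e) := by
  induction ha using Submodule.span_induction with
  | mem x hx =>
    obtain ⟨m, hm, rfl⟩ := hx
    exact Homog_le_DegLT (Nat.add_lt_add_right hm e) (mul_mem_Homog rel (mon_mem_Homog m) hb)
  | zero => simp
  | add x y _ _ hx hy => rw [add_mul]; exact add_mem hx hy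
  | smul c x _ hx => rw [smul_mul_assoc]; exact Submodule.smul_mem _ _ hx

lemma exists_top_component {d : ℕ} {a : A} (ha : a ∈ DegLT k u v (d + 1)) :
    ∃ b ∈ Homog k u v d, a - b ∈ DegLT k u v d := by
  have hle : DegLT k u v (d + 1) ≤ Homog k u v d ⊔ DegLT k u v d := by
    rw [DegLT, DegLT, Homog, ← Submodule.span_union, ← Set.image_union]
    refine Submodule.span_mono (Set.image_mono fun m hm => ?_)
    exact (Nat.lt_succ_iff.1 hm).eq_or_lt
  obtain ⟨b, hb, c, hc, rfl⟩ := Submodule.mem_sup.1 (hle ha)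
  exact ⟨b, hb, by simpa using hc⟩

lemma IsPBW.exists_top_form (h : IsPBW q p u v) {a : A} (ha : a ≠ 0) :
    ∃ b d, b ≠ 0 ∧ b ∈ Homog k u v d ∧ a - b ∈ DegLT k u v d := by
  classical
  have hex := h.exists_mem_DegLT a
  obtain ⟨d, hd⟩ : ∃ d, Nat.find hex = d + 1 := by
    refine Nat.exists_eq_succ_of_ne_zero fun h0 => ha ?_
    have h1 := Nat.find_spec hex
    rw [h0] at h1
    simpa [DegLT] using h1
  have h1 := Nat.find_spec hex
  rw [hd] at h1
  obtain ⟨b, hb, hab⟩ := exists_top_component h1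
  refine ⟨b, d, ?_, hb, hab⟩
  rintro rfl
  exact Nat.find_min hex (m := d) (by omega) (by simpa using hab)

lemma IsPBW.eq_zero_of_mem (h : IsPBW q p u v) {d : ℕ} {a : A} (h1 : a ∈ Homog k u v d)
    (h2 : a ∈ DegLT k u v d) : a = 0 := by
  apply h.basis.repr.injective
  ext m
  by_cases hm : tdeg m = d
  · simpa using h.mem_DegLT_iff.1 h2 m hm.ge
  · simpa using h.mem_Homog_iff.1 h1 m hm

variable {G T : Type*} [Group G] [Fintype G] [MulSemiringAction G A] [Ring T]
  {ι : A →+* T} {j : G → T} (H : IsSkewGroupRing A G T ι j)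

namespace IsSkewGroupRing

/-- The elements of the skew group ring whose coefficients lie in a given subspace. -/
def coeffsIn (P : Submodule k A) : AddSubgroup T where
  carrier := {t | ∀ y, H.coef t y ∈ P}
  zero_mem' := fun y => by rw [H.coef_zero]; exact zero_mem _
  add_mem' := fun hs ht y => by rw [H.coef_add]; exact add_mem (hs y) (ht y)
  neg_mem' := fun ht y => by rw [H.coef_neg]; exact neg_mem (ht y)

lemma coeffsIn_mono {P P' : Submodule k A} (hP : P ≤ P') : H.coeffsIn P ≤ H.coeffsIn P' :=
  fun _ ht y => hP (ht y)

lemma ι_mem_coeffsIn {P : Submodule k A} {a : A} (ha : a ∈ P) : ι a ∈ H.coeffsIn P := by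
  classical
  intro y
  rw [H.coef_ι]
  split_ifs
  · exact ha
  · exact zero_mem _

lemma mul_mem_coeffsIn {P P' P'' : Submodule k A} (hsmul : ∀ (g : G), ∀ a ∈ P', g • a ∈ P')
    (hmul : ∀ a ∈ P, ∀ b ∈ P', a * b ∈ P'') {s t : T} (hs : s ∈ H.coeffsIn P)
    (ht : t ∈ H.coeffsIn P') : s * t ∈ H.coeffsIn P'' := fun y => by
  rw [H.coef_mul]
  exact Submodule.sum_mem _ fun g _ => hmul _ (hs g) _ (hsmul g _ (ht _))

section

variable (h : IsPBW q p u v)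
include h

lemma eq_zero_of_mem_coeffsIn {d : ℕ} {t : T} (h1 : t ∈ H.coeffsIn (Homog k u v d))
    (h2 : t ∈ H.coeffsIn (DegLT k u v d)) : t = 0 :=
  H.ext fun y => by rw [h.eq_zero_of_mem (h1 y) (h2 y), H.coef_zero]

lemma exists_mem_coeffsIn_DegLT (t : T) : ∃ d, t ∈ H.coeffsIn (DegLT k u v d) := by
  choose D hD using fun g => h.exists_mem_DegLT (H.coef t g)
  exact ⟨Finset.univ.sup D, fun g => DegLT_mono (Finset.le_sup (Finset.mem_univ g)) (hD g)⟩

end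

/-- `s` is the leading form of `t`, of degree `d`. -/
def IsSymbol (k : Type*) [Field k] [Algebra k A] (u v : A) (d : ℕ) (t s : T) : Prop :=
  s ∈ H.coeffsIn (Homog k u v d) ∧ t - s ∈ H.coeffsIn (DegLT k u v d)

lemma exists_isSymbol_of_mem {d : ℕ} {t : T} (ht : t ∈ H.coeffsIn (DegLT k u v (d + 1))) :
    ∃ s, H.IsSymbol k u v d t s := by
  choose c hc hc' using fun y => exists_top_component (ht y)
  refine ⟨∑ y, ι (c y) * j y, fun y => ?_, fun y => ?_⟩
  · rw [H.coef_sum]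
    exact hc y
  · rw [H.coef_sub, H.coef_sum]
    exact hc' y

lemma exists_isSymbol (h : IsPBW q p u v) {t : T} (ht : t ≠ 0) :
    ∃ d s, s ≠ 0 ∧ H.IsSymbol k u v d t s := by
  classical
  have hex := H.exists_mem_coeffsIn_DegLT h t
  obtain ⟨d, hd⟩ : ∃ d, Nat.find hex = d + 1 := by
    refine Nat.exists_eq_succ_of_ne_zero fun h0 => ht (H.ext fun y => ?_)
    have h1 := Nat.find_spec hex y
    rw [h0] at h1
    simpa [DegLT, H.coef_zero] using h1
  have h1 := Nat.find_spec hex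
  rw [hd] at h1
  obtain ⟨s, hs⟩ := H.exists_isSymbol_of_mem h1
  refine ⟨d, s, ?_, hs⟩
  rintro rfl
  exact Nat.find_min hex (m := d) (by omega) (by simpa using hs.2)

lemma IsSymbol.unique (h : IsPBW q p u v) {d d' : ℕ} {t s s' : T}
    (hs : H.IsSymbol k u v d t s) (hs' : H.IsSymbol k u v d' t s') (h0 : s ≠ 0) (h0' : s' ≠ 0) :
    d = d' ∧ s = s' := by
  have key : ∀ {d d' : ℕ} {s s' : T}, H.IsSymbol k u v d t s → H.IsSymbol k u v d' t s' →
      s' ≠ 0 → ¬ d < d' := by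
    intro d d' s s' hs hs' h0' hlt
    refine h0' (H.eq_zero_of_mem_coeffsIn h hs'.1 ?_)
    have h1 := add_mem (H.coeffsIn_mono (DegLT_mono hlt.le) hs.2)
      (H.coeffsIn_mono (Homog_le_DegLT hlt) hs.1)
    have h2 := sub_mem h1 hs'.2
    simpa using h2
  obtain rfl : d = d' := le_antisymm (not_lt.1 (key hs' hs h0)) (not_lt.1 (key hs hs' h0'))
  refine ⟨rfl, sub_eq_zero.1 (H.eq_zero_of_mem_coeffsIn h (sub_mem hs.1 hs'.1) ?_)⟩
  simpa using sub_mem hs'.2 hs.2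

lemma IsSymbol.self {d : ℕ} {t : T} (ht : t ∈ H.coeffsIn (Homog k u v d)) :
    H.IsSymbol k u v d t t := ⟨ht, by rw [sub_self]; exact zero_mem _⟩

lemma homog_induction (h : IsPBW q p u v) {P : T → Prop} (hadd : ∀ s t, P s → P t → P (s + t)) (h0 : P 0)
    (hP : ∀ d, ∀ t ∈ H.coeffsIn (Homog k u v d), P t) (t : T) : P t := by
  obtain ⟨d, hd⟩ := H.exists_mem_coeffsIn_DegLT h t
  induction d generalizing t with
  | zero =>
    convert h0
    exact H.ext fun y => by simpa [DegLT, H.coef_zero] using hd y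
  | succ d ih =>
    obtain ⟨s, hs⟩ := H.exists_isSymbol_of_mem hd
    rw [← sub_add_cancel t s]
    exact hadd _ _ (ih _ hs.2) (hP d s hs.1)

section

variable [SMulCommClass G k A] (h : IsPBW q p u v)
  (hG : ∀ g : G, g • u ∈ Homog k u v 1 ∧ g • v ∈ Homog k u v 1)
include h hG

lemma IsSymbol.mul {d d' : ℕ} {t t' s s' : T} (hs : H.IsSymbol k u v d t s)
    (hs' : H.IsSymbol k u v d' t' s') : H.IsSymbol k u v (d + d') (t * t') (s * s') := by
  have h1 : ∀ (g : G), ∀ a ∈ Homog k u v d', g • a ∈ Homog k u v d' := fun g a ha =>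
    smul_mem_Homog h.rel (hG g).1 (hG g).2 ha
  have h2 : ∀ (g : G), ∀ a ∈ DegLT k u v d', g • a ∈ DegLT k u v d' := fun g a ha =>
    smul_mem_DegLT h.rel (hG g).1 (hG g).2 ha
  refine ⟨H.mul_mem_coeffsIn h1 (fun a ha b hb => mul_mem_Homog h.rel ha hb) hs.1 hs'.1, ?_⟩
  have e : t * t' - s * s' = s * (t' - s') + (t - s) * s' + (t - s) * (t' - s') := by noncomm_ring
  rw [e]
  exact add_mem (add_mem
    (H.mul_mem_coeffsIn h2 (fun a ha b hb => Homog_mul_mem_DegLT h.rel ha hb) hs.1 hs'.2)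
    (H.mul_mem_coeffsIn h1 (fun a ha b hb => DegLT_mul_mem_DegLT h.rel ha hb) hs.2 hs'.1))
    (H.mul_mem_coeffsIn h2 (fun a ha b hb => mul_mem_DegLT h.rel ha hb) hs.2 hs'.2)

end

/-- The additive subgroup generated by the leading forms of the elements of `J`. -/
def symbols (k : Type*) [Field k] [Algebra k A] (u v : A) (J : AddSubgroup T) : AddSubgroup T :=
  AddSubgroup.closure {s | ∃ d, ∃ t ∈ J, H.IsSymbol k u v d t s}

lemma symbols_ne_bot (h : IsPBW q p u v) {J : AddSubgroup T} (hJ : J ≠ ⊥) :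
    H.symbols k u v J ≠ ⊥ := by
  obtain ⟨⟨b, hb⟩, hb0⟩ := AddSubgroup.ne_bot_iff_exists_ne_zero.1 hJ
  obtain ⟨d, s, hs0, hs⟩ := H.exists_isSymbol h (t := b) fun h0 => hb0 (Subtype.ext h0)
  exact AddSubgroup.ne_bot_of_mem (AddSubgroup.subset_closure ⟨d, b, hb, hs⟩) hs0

section

variable [SMulCommClass G k A] (h : IsPBW q p u v)
  (hG : ∀ g : G, g • u ∈ Homog k u v 1 ∧ g • v ∈ Homog k u v 1)
include h hG

lemma isTwoSided_symbols {J : AddSubgroup T} (hJ : IsTwoSided J) :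
    IsTwoSided (H.symbols k u v J) := by
  constructor
  · intro r s hs
    induction r using H.homog_induction h with
    | hadd r r' h1 h2 => rw [add_mul]; exact add_mem h1 h2
    | h0 => rw [zero_mul]; exact zero_mem _
    | hP e r hr =>
      induction hs using AddSubgroup.closure_induction with
      | mem s hs =>
        obtain ⟨d, t, ht, hts⟩ := hs
        exact AddSubgroup.subset_closure ⟨_, _, hJ.mul_left r t ht,
          IsSymbol.mul H h hG (IsSymbol.self H hr) hts⟩
      | zero => rw [mul_zero]; exact zero_mem _
      | add a b _ _ h1 h2 => rw [mul_add]; exact add_mem h1 h2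
      | neg a _ h1 => rw [mul_neg]; exact neg_mem h1
  · intro r s hs
    induction r using H.homog_induction h with
    | hadd r r' h1 h2 => rw [mul_add]; exact add_mem h1 h2
    | h0 => rw [mul_zero]; exact zero_mem _
    | hP e r hr =>
      induction hs using AddSubgroup.closure_induction with
      | mem s hs =>
        obtain ⟨d, t, ht, hts⟩ := hs
        exact AddSubgroup.subset_closure ⟨_, _, hJ.mul_right r t ht,
          IsSymbol.mul H h hG hts (IsSymbol.self H hr)⟩
      | zero => rw [zero_mul]; exact zero_mem _
      | add a b _ _ h1 h2 => rw [add_mul]; exact add_mem h1 h2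
      | neg a _ h1 => rw [neg_mul]; exact neg_mem h1

/-- It suffices to treat elements of the quotient ring that are fractions of homogeneous
elements. -/
theorem leftStable_of_homog {Q : Type*} [Ring Q] {f : T →+* Q} (hf : IsGoldieQuotientRing f)
    (hgr : ∀ L : AddSubgroup T, IsTwoSided L → L ≠ ⊥ → ∀ d, ∀ z ∈ Homog k u v d, z ≠ 0 →
      ∀ e, ∀ a ∈ H.coeffsIn (Homog k u v e), ∀ x : Q, f (ι z) * x = f a →
      (∀ b ∈ L, ∃ c ∈ L, x * f b = f c) → ∃ t, a = ι z * t) : LeftStable f := by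
  intro J hJ hJ0 x hx
  have hunit : ∀ {z : A}, z ≠ 0 → IsUnit (f (ι z)) := fun hz =>
    hf.isUnit_of_regular _ (isRegular_ι H h hz)
  have hι0 : ∀ {z : A}, z ≠ 0 → ι z ≠ 0 := fun hz h0 => hz (H.injective (by rw [h0, map_zero]))
  have hcancel : ∀ {z : A} {t : T}, z ≠ 0 → ι z * t = 0 → t = 0 := fun hz h0 =>
    (isRegular_ι H h hz).left (by simpa using h0)
  obtain ⟨z, hz0, a, hza⟩ := exists_denominator H h hG hf x
  obtain ⟨z', d, hz'0, hz', hzz'⟩ := h.exists_top_form hz0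
  have hzs : H.IsSymbol k u v d (ι z) (ι z') := ⟨H.ι_mem_coeffsIn hz', by
    rw [← map_sub]; exact H.ι_mem_coeffsIn hzz'⟩
  obtain ⟨e, he⟩ := H.exists_mem_coeffsIn_DegLT h a
  induction e generalizing x a with
  | zero =>
    have ha : a = 0 := H.ext fun y => by simpa [DegLT, H.coef_zero] using he y
    refine ⟨0, (hunit hz0).mul_left_cancel ?_⟩
    rw [hza, ha, map_zero, mul_zero]
  | succ e ih =>
    obtain ⟨a', ha'⟩ := H.exists_isSymbol_of_mem he
    obtain ⟨x', hx'⟩ : ∃ x', f (ι z') * x' = f a' := by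
      obtain ⟨w, hw⟩ := hunit hz'0
      exact ⟨w⁻¹.1 * f a', by rw [← hw, Units.mul_inv_cancel_left]⟩
    obtain ⟨t, ht⟩ : ∃ t, a' = ι z' * t := by
      refine hgr _ (H.isTwoSided_symbols h hG hJ) (H.symbols_ne_bot h hJ0) d z' hz' hz'0 e a' ha'.1
        x' hx' fun s hs => ?_
      induction hs using AddSubgroup.closure_induction with
      | mem s hs =>
        obtain ⟨d1, b, hb, hbs⟩ := hs
        by_cases h0 : a' * s = 0
        · refine ⟨0, zero_mem _, (hunit hz'0).mul_left_cancel ?_⟩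
          rw [← mul_assoc, hx', ← map_mul, h0, map_zero, mul_zero]
        obtain ⟨b', hb', hxb⟩ := hx b hb
        have hzb : ι z * b' = a * b := hf.injective (by
          rw [map_mul, map_mul, ← hxb, ← mul_assoc, hza])
        have hab := IsSymbol.mul H h hG ha' hbs
        have hb'0 : b' ≠ 0 := by
          rintro rfl
          rw [← hzb, mul_zero] at hab
          refine h0 (H.eq_zero_of_mem_coeffsIn h hab.1 ?_)
          simpa using neg_mem hab.2
        obtain ⟨d2, s', hs'0, hs'⟩ := H.exists_isSymbol h hb'0
        have hzb' := IsSymbol.mul H h hG hzs hs'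
        rw [hzb] at hzb'
        have heq := (IsSymbol.unique H h hzb' hab (fun h1 => hs'0 (hcancel hz'0 h1)) h0).2
        refine ⟨s', AddSubgroup.subset_closure ⟨d2, b', hb', hs'⟩, (hunit hz'0).mul_left_cancel ?_⟩
        rw [← mul_assoc, hx', ← map_mul, ← map_mul, heq]
      | zero => exact ⟨0, zero_mem _, by simp⟩
      | add b b' _ _ h1 h2 =>
        obtain ⟨c, hc, hc'⟩ := h1
        obtain ⟨c', hc1, hc1'⟩ := h2
        exact ⟨c + c', add_mem hc hc1, by rw [map_add, mul_add, hc', hc1', map_add]⟩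
      | neg b _ h1 =>
        obtain ⟨c, hc, hc'⟩ := h1
        exact ⟨-c, neg_mem hc, by rw [map_neg, mul_neg, hc', map_neg]⟩
    by_cases ht0 : t = 0
    · rw [ht0, mul_zero] at ht
      subst ht
      exact ih x hx a hza (by simpa using ha'.2)
    obtain ⟨d1, t1, ht10, ht1⟩ := H.exists_isSymbol h ht0
    have h1 := IsSymbol.mul H h hG (IsSymbol.self H (H.ι_mem_coeffsIn hz')) ht1
    rw [← ht] at h1
    obtain ⟨rfl, h3⟩ := IsSymbol.unique H h h1 (IsSymbol.self H ha'.1)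
      (fun h1 => ht10 (hcancel hz'0 h1)) (by
        rw [ht]; exact fun h1 => ht0 (hcancel hz'0 h1))
    have h4 := IsSymbol.mul H h hG hzs ht1
    rw [h3] at h4
    obtain ⟨t2, ht2⟩ := ih (x - f t) (fun b hb => by
        obtain ⟨c, hc, hc'⟩ := hx b hb
        exact ⟨c - t * b, sub_mem hc (hJ.mul_left t b hb), by
          rw [sub_mul, hc', map_sub, map_mul]⟩)
      (a - ι z * t) (by rw [mul_sub, hza, map_sub, map_mul])
      (by simpa using sub_mem ha'.2 h4.2)
    exact ⟨t2 + t, by rw [map_add, ← ht2, sub_add_cancel]⟩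

end

end IsSkewGroupRing

end Symbols

section CyclicStable

variable {k A C T : Type*} [Field k] [Ring A] [Algebra k A] [Group C] [Fintype C]
  [MulSemiringAction C A] [SMulCommClass C k A] [Ring T] {ι : A →+* T} {j : C → T}
  {q p : k} {u v : A} {n : ℕ} {ω : k} {g : C}

/-- The algebra structure of the skew group ring over the ground field of `A`. -/
abbrev IsSkewGroupRing.algebra (k : Type*) [Field k] [Algebra k A] [SMulCommClass C k A]
    (H : IsSkewGroupRing A C T ι j) : Algebra k T :=
  (ι.comp (algebraMap k A)).toAlgebra' fun c t => by
    refine H.ext fun y => ?_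
    rw [RingHom.comp_apply, H.coef_ι_mul, H.coef_mul_ι, smul_algebraMap, Algebra.commutes]

namespace IsDiagonalAction

variable (D : IsDiagonalAction n ω g u v)
include D

theorem exists_eq_of_stable (H : IsSkewGroupRing A C T ι j) [CharZero k] (h : IsPBW q p u v)
    {Q : Type*} [Ring Q] {f : T →+* Q} (hf : Function.Injective f) {J : AddSubgroup T}
    (hJ : IsTwoSided J) (hJ0 : J ≠ ⊥) {z : A} (hz0 : z ≠ 0) (hz : ∀ y, f (ι z) * y = 0 → y = 0)
    {x : Q} {a : T} (hza : f (ι z) * x = f a) (hx : ∀ b ∈ J, ∃ c ∈ J, x * f b = f c) :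
    ∃ t, x = f t := by
  let := H.algebra k
  have hι : ∀ (c : k) (a : A), ι (c • a) = c • ι a := fun c a => by
    rw [Algebra.smul_def, Algebra.smul_def, map_mul]
    rfl
  exact D.mem_range_of_stable H hι h hf hJ hJ0 hz0 hz hza hx

omit [Fintype C] in
lemma smul_mem_Homog_one (x : C) : x • u ∈ Homog k u v 1 ∧ x • v ∈ Homog k u v 1 := by
  obtain ⟨i, rfl⟩ := D.generates x
  have hu : g ^ i • u = ω ^ i • u := by
    induction i with
    | zero => simp
    | succ i ih => rw [pow_succ, mul_smul, D.smul_u, smul_comm, ih, smul_smul, pow_succ']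
  have hv : g ^ i • v = ω⁻¹ ^ i • v := by
    clear hu
    induction i with
    | zero => simp
    | succ i ih => rw [pow_succ, mul_smul, D.smul_v, smul_comm, ih, smul_smul, pow_succ']
  rw [hu, hv]
  exact ⟨Submodule.smul_mem _ _ u_mem_Homog, Submodule.smul_mem _ _ v_mem_Homog⟩

theorem leftStable (H : IsSkewGroupRing A C T ι j) [CharZero k] (h : IsPBW q p u v)
    {Q : Type*} [Ring Q] {f : T →+* Q} (hf : IsGoldieQuotientRing f) : LeftStable f := by
  intro J hJ hJ0 x hx
  obtain ⟨z, hz0, a, hza⟩ := exists_denominator H h D.smul_mem_Homog_one hf x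
  have hu := hf.isUnit_of_regular _ (isRegular_ι H h hz0)
  exact D.exists_eq_of_stable H h hf.injective hJ hJ0 hz0 (fun y hy => hu.mul_right_eq_zero.1 hy)
    hza hx

end IsDiagonalAction

end CyclicStable

section SubgroupRing

variable {A G T : Type*} [Ring A] [Group G] [Fintype G] [MulSemiringAction G A] [Ring T]
  {ι : A →+* T} {j : G → T} (H : IsSkewGroupRing A G T ι j)

namespace IsSkewGroupRing

/-- The subring of the elements of a skew group ring supported on a subgroup. -/
def supportedOn (C : Subgroup G) : Subring T where
  carrier := {t | ∀ y ∉ C, H.coef t y = 0}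
  zero_mem' := fun y _ => H.coef_zero y
  add_mem' := fun hs ht y hy => by rw [H.coef_add, hs y hy, ht y hy, add_zero]
  neg_mem' := fun ht y hy => by rw [H.coef_neg, ht y hy, neg_zero]
  one_mem' := fun y hy => by
    classical
    rw [H.coef_one, if_neg (by rintro rfl; exact hy C.one_mem)]
  mul_mem' := fun {s t} hs ht y hy => by
    rw [H.coef_mul]
    refine Finset.sum_eq_zero fun x _ => ?_
    by_cases hx : x ∈ C
    · rw [ht _ (fun h => hy (by simpa using C.mul_mem hx h)), smul_zero, mul_zero]
    · rw [hs x hx, zero_mul]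

lemma ι_mem_supportedOn (C : Subgroup G) (a : A) : ι a ∈ H.supportedOn C := fun y hy => by
  classical
  rw [H.coef_ι, if_neg (by rintro rfl; exact hy C.one_mem)]

lemma j_mem_supportedOn {C : Subgroup G} {x : G} (hx : x ∈ C) : j x ∈ H.supportedOn C :=
  fun y hy => by
    classical
    rw [H.coef_j, if_neg (by rintro rfl; exact hy hx)]

lemma isSkewGroupRing_supportedOn (C : Subgroup G) [Fintype C] :
    IsSkewGroupRing A C (H.supportedOn C)
      (ι.codRestrict (H.supportedOn C) (H.ι_mem_supportedOn C))
      (fun x => ⟨j x, H.j_mem_supportedOn x.2⟩) := by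
  classical
  have hcoef : ∀ (c : C → A) (y : G), H.coef (∑ x : C, ι (c x) * j x) y =
      if hy : y ∈ C then c ⟨y, hy⟩ else 0 := by
    intro c y
    rw [H.coef_finset_sum]
    simp only [H.coef_ι_mul, H.coef_j]
    split_ifs with hy
    · rw [Finset.sum_eq_single ⟨y, hy⟩]
      · simp
      · intro x _ hx
        rw [if_neg (by rintro rfl; exact hx rfl), mul_zero]
      · simp
    · refine Finset.sum_eq_zero fun x _ => ?_
      rw [if_neg (by rintro rfl; exact hy x.2), mul_zero]
  refine ⟨fun a b hab => H.injective (congrArg Subtype.val hab), Subtype.ext H.j_one,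
    fun x y => Subtype.ext (H.j_mul x y), fun x a => Subtype.ext (H.comm x a), fun t => ?_⟩
  refine ⟨fun x => H.coef t x, Subtype.ext (H.ext fun y => ?_), fun c hc => funext fun x => ?_⟩
  · simp only [AddSubmonoidClass.coe_finsetSum, Subring.coe_mul, RingHom.codRestrict_apply]
    rw [hcoef fun x => H.coef t x]
    split_ifs with hy
    · rfl
    · exact t.2 y hy
  · rw [hc]
    simp only [AddSubmonoidClass.coe_finsetSum, Subring.coe_mul, RingHom.codRestrict_apply]
    rw [hcoef c, dif_pos x.2]

end IsSkewGroupRing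

end SubgroupRing

section SkewPlane

variable {k A : Type*} [Field k] [Ring A] [Algebra k A] {u v : A}

namespace IsPBW

variable (h : IsPBW (-1 : k) 0 u v)
include h

lemma v_mul_u : v * u = -(u * v) := by simpa using h.rel

lemma commute_of_generators {c : A} (hu : Commute c u) (hv : Commute c v) (a : A) :
    Commute c a := by
  induction h.span (Submodule.mem_top (x := a)) using Submodule.span_induction with
  | mem x hx =>
    obtain ⟨m, rfl⟩ := hx
    exact (hu.pow_right _).mul_right (hv.pow_right _)
  | zero => exact Commute.zero_right c
  | add x y _ _ hx hy => exact hx.add_right hy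
  | smul r x _ hx => exact hx.smul_right r

lemma commute_u_pow (n : ℕ) (a : A) : Commute (u ^ (2 * n)) a := by
  rw [pow_mul]
  refine Commute.pow_left (h.commute_of_generators ((Commute.refl u).pow_left 2) ?_ a) n
  rw [Commute, SemiconjBy, sq, mul_assoc, ← mul_assoc v, h.v_mul_u, neg_mul, mul_assoc, h.v_mul_u]
  simp

lemma commute_v_pow (n : ℕ) (a : A) : Commute (v ^ (2 * n)) a := by
  rw [pow_mul]
  refine Commute.pow_left (h.commute_of_generators ?_ ((Commute.refl v).pow_left 2) a) n
  rw [Commute, SemiconjBy, sq, mul_assoc, h.v_mul_u, mul_neg, ← mul_assoc, h.v_mul_u]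
  simp [mul_assoc]

lemma uv_mul {d : ℕ} {a : A} (ha : a ∈ Homog k u v d) :
    u * v * a = ((-1 : ℤ) ^ d) • (a * (u * v)) := by
  have hu : ∀ i, u * v * u ^ i = ((-1 : ℤ) ^ i) • (u ^ i * (u * v)) := fun i => by
    induction i with
    | zero => simp
    | succ i ih =>
      rw [pow_succ, ← mul_assoc, ih, smul_mul_assoc, mul_assoc, mul_assoc, h.v_mul_u, pow_succ]
      simp [mul_assoc]
  have hv : ∀ i, u * v * v ^ i = ((-1 : ℤ) ^ i) • (v ^ i * (u * v)) := fun i => by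
    induction i with
    | zero => simp
    | succ i ih =>
      rw [pow_succ, ← mul_assoc, ih, smul_mul_assoc, mul_assoc, mul_assoc (v ^ i) v,
        ← mul_assoc v u, h.v_mul_u, pow_succ]
      simp
  induction ha using Submodule.span_induction with
  | mem x hx =>
    obtain ⟨m, rfl, rfl⟩ := hx
    rw [mon, ← mul_assoc, hu, smul_mul_assoc, mul_assoc, hv, mul_smul_comm, smul_smul, ← mul_assoc,
      ← pow_add, tdeg, add_comm]
  | zero => simp
  | add x y _ _ hx hy => rw [mul_add, hx, hy, add_mul, smul_add]
  | smul c x _ hx => rw [mul_smul_comm, hx, smul_mul_assoc, smul_comm]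

lemma v_mul_mon (j i : ℕ) :
    v * mon u v (toLex (j, i)) = ((-1 : k) ^ i) • mon u v (toLex (j + 1, i)) := by
  have hu : v * u ^ i = ((-1 : k) ^ i) • (u ^ i * v) := by
    induction i with
    | zero => simp
    | succ i ih =>
      rw [pow_succ, ← mul_assoc, ih, smul_mul_assoc, mul_assoc, h.v_mul_u, pow_succ]
      simp [mul_assoc]
  rw [mon, ← mul_assoc]
  simp only [ofLex_toLex]
  rw [hu, smul_mul_assoc, mul_assoc, ← pow_succ', mon]
  rfl

omit h in
lemma u_mul_mon_toLex (u v : A) (j i : ℕ) :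
    u * mon u v (toLex (j, i)) = mon u v (toLex (j, i + 1)) := by
  rw [u_mul_mon, add_comm]
  rfl

lemma repr_eq_of_mon {φ ψ : A →ₗ[k] k} (hφ : ∀ j i, φ (mon u v (toLex (j, i))) =
    ψ (mon u v (toLex (j, i)))) (a : A) : φ a = ψ a := by
  have : φ = ψ := h.basis.ext fun m => by rw [h.basis_apply]; exact hφ _ _
  rw [this]

lemma repr_u_mul (a : A) (j i : ℕ) :
    h.basis.repr (u * a) (toLex (j, i + 1)) = h.basis.repr a (toLex (j, i)) := by
  refine h.repr_eq_of_mon (φ := Finsupp.lapply (toLex (j, i + 1)) ∘ₗ h.basis.repr.toLinearMap ∘ₗ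
    LinearMap.mulLeft k u) (ψ := Finsupp.lapply (toLex (j, i)) ∘ₗ h.basis.repr.toLinearMap)
    (fun j' i' => ?_) a
  simp [u_mul_mon_toLex, h.repr_mon]

lemma repr_u_mul_zero (a : A) (j : ℕ) : h.basis.repr (u * a) (toLex (j, 0)) = 0 := by
  refine h.repr_eq_of_mon (φ := Finsupp.lapply (toLex (j, 0)) ∘ₗ h.basis.repr.toLinearMap ∘ₗ
    LinearMap.mulLeft k u) (ψ := 0) (fun j' i' => ?_) a
  simp [u_mul_mon_toLex, h.repr_mon]

lemma repr_v_mul (a : A) (j i : ℕ) :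
    h.basis.repr (v * a) (toLex (j + 1, i)) = (-1 : k) ^ i * h.basis.repr a (toLex (j, i)) := by
  refine h.repr_eq_of_mon (φ := Finsupp.lapply (toLex (j + 1, i)) ∘ₗ h.basis.repr.toLinearMap ∘ₗ
    LinearMap.mulLeft k v)
    (ψ := (-1 : k) ^ i • (Finsupp.lapply (toLex (j, i)) ∘ₗ h.basis.repr.toLinearMap))
    (fun j' i' => ?_) a
  by_cases hi : i' = i
  · simp [h.v_mul_mon, h.repr_mon, hi]
  · simp [h.v_mul_mon, h.repr_mon, hi]

lemma repr_v_mul_zero (a : A) (i : ℕ) : h.basis.repr (v * a) (toLex (0, i)) = 0 := by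
  refine h.repr_eq_of_mon (φ := Finsupp.lapply (toLex (0, i)) ∘ₗ h.basis.repr.toLinearMap ∘ₗ
    LinearMap.mulLeft k v) (ψ := 0) (fun j' i' => ?_) a
  simp [h.v_mul_mon, h.repr_mon]

lemma repr_u_pow_mul (N : ℕ) (a : A) (j i : ℕ) :
    h.basis.repr (u ^ N * a) (toLex (j, i + N)) = h.basis.repr a (toLex (j, i)) := by
  induction N generalizing i with
  | zero => simp
  | succ N ih => rw [pow_succ', mul_assoc, ← add_assoc, h.repr_u_mul, ih]

lemma repr_v_pow_mul (N : ℕ) (a : A) (j : ℕ) :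
    h.basis.repr (v ^ N * a) (toLex (j + N, 0)) = h.basis.repr a (toLex (j, 0)) := by
  induction N generalizing j with
  | zero => simp
  | succ N ih => rw [pow_succ', mul_assoc, ← add_assoc, h.repr_v_mul, ih, pow_zero, one_mul]

lemma exists_eq_uv_mul {a : A} (h1 : ∀ j, h.basis.repr a (toLex (j, 0)) = 0)
    (h2 : ∀ i, h.basis.repr a (toLex (0, i)) = 0) : ∃ b, a = u * v * b := by
  have h3 : a ∈ Submodule.span k (h.basis '' {m | (ofLex m).1 ≠ 0 ∧ (ofLex m).2 ≠ 0}) := by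
    rw [h.basis.mem_span_image]
    intro m hm
    refine ⟨fun h0 => Finsupp.mem_support_iff.1 hm ?_, fun h0 => Finsupp.mem_support_iff.1 hm ?_⟩
    · convert h2 (ofLex m).2
      rw [← h0]
      rfl
    · convert h1 (ofLex m).1
      rw [← h0]
      rfl
  have h4 : Submodule.span k (h.basis '' {m | (ofLex m).1 ≠ 0 ∧ (ofLex m).2 ≠ 0}) ≤
      LinearMap.range (LinearMap.mulLeft k (u * v)) := by
    rw [Submodule.span_le]
    rintro _ ⟨m, ⟨hm1, hm2⟩, rfl⟩
    obtain ⟨j, hj⟩ := Nat.exists_eq_succ_of_ne_zero hm1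
    obtain ⟨i, hi⟩ := Nat.exists_eq_succ_of_ne_zero hm2
    refine ⟨(-1 : k) ^ i • mon u v (toLex (j, i)), ?_⟩
    have hm : m = toLex (j, i) + toLex (1, 1) := by
      apply ofLex.injective
      ext
      · exact hj
      · exact hi
    rw [h.basis_apply, hm, LinearMap.mulLeft_apply, mul_smul_comm, mul_assoc, h.v_mul_mon,
      mul_smul_comm, smul_smul, ← mul_pow, neg_one_mul, neg_neg, one_pow, one_smul, u_mul_mon_toLex]
    rfl
  obtain ⟨b, hb⟩ := h4 h3
  exact ⟨b, hb.symm⟩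

lemma exists_eq_uv_mul_of_eq {N : ℕ} (hN : 0 < N) {a b : A}
    (hab : (v ^ N - u ^ N) * a = u * v * b) : ∃ c, a = u * v * c := by
  have hb1 : ∀ j, h.basis.repr (u * v * b) (toLex (j, 0)) = 0 := fun j => by
    rw [mul_assoc, h.repr_u_mul_zero]
  have hb2 : ∀ i, h.basis.repr (u * v * b) (toLex (0, i)) = 0 := fun i => by
    rw [mul_assoc]
    cases i with
    | zero => exact h.repr_u_mul_zero _ _
    | succ i => rw [h.repr_u_mul, h.repr_v_mul_zero]
  obtain ⟨N, rfl⟩ := Nat.exists_eq_succ_of_ne_zero hN.ne'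
  refine h.exists_eq_uv_mul (fun j => ?_) fun i => ?_
  · have h1 := hb1 (j + (N + 1))
    rwa [← hab, sub_mul, map_sub, Finsupp.sub_apply, Nat.succ_eq_add_one, h.repr_v_pow_mul,
      pow_succ' u, mul_assoc u, h.repr_u_mul_zero, sub_zero] at h1
  · have h1 := hb2 (i + (N + 1))
    rwa [← hab, sub_mul, map_sub, Finsupp.sub_apply, Nat.succ_eq_add_one, h.repr_u_pow_mul,
      pow_succ' v, mul_assoc v, h.repr_v_mul_zero, zero_sub, neg_eq_zero] at h1

end IsPBW

end SkewPlane

section Dihedral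

/-- The action of a dihedral group: the rotation `g` of order `n` scales `u` by `ω` and `v` by
`ω⁻¹`, and the reflection `h` exchanges `u` and `v`. -/
structure IsDihedralAction {k A G : Type*} [Field k] [Ring A] [Algebra k A] [Group G]
    [MulSemiringAction G A] (n : ℕ) (ω : k) (g h : G) (u v : A) : Prop where
  pos : 0 < n
  prim : IsPrimitiveRoot ω n
  order : orderOf g = n
  generates : ∀ x : G, ∃ i : ℕ, x = g ^ i ∨ x = g ^ i * h
  rot_u : g • u = ω • u
  rot_v : g • v = ω⁻¹ • v
  refl_u : h • u = v
  refl_v : h • v = u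

variable {k A G T : Type*} [Field k] [Ring A] [Algebra k A] [Group G] [Fintype G]
  [MulSemiringAction G A] [SMulCommClass G k A] [Ring T] {ι : A →+* T} {j : G → T}
  {u v : A} {n : ℕ} {ω : k} {g h : G}

lemma exists_eq_pow_of_mem_zpowers {G : Type*} [Group G] [Finite G] {g y : G}
    (hy : y ∈ Subgroup.zpowers g) : ∃ i : ℕ, y = g ^ i := by
  obtain ⟨i, hi⟩ := mem_powers_iff_mem_zpowers.2 hy
  exact ⟨i, hi.symm⟩

namespace IsDihedralAction

variable (D : IsDihedralAction n ω g h u v)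
include D

omit [Fintype G] [SMulCommClass G k A] in
lemma exists_eq_of_notMem {y : G} (hy : y ∉ Subgroup.zpowers g) : ∃ i : ℕ, y = g ^ i * h := by
  obtain ⟨i, rfl | rfl⟩ := D.generates y
  · exact absurd (pow_mem (Subgroup.mem_zpowers g) i) hy
  · exact ⟨i, rfl⟩

omit [SMulCommClass G k A] in
lemma isDiagonalAction :
    IsDiagonalAction n ω (⟨g, Subgroup.mem_zpowers g⟩ : Subgroup.zpowers g) u v where
  pos := D.pos
  prim := D.prim
  order := by rw [Subgroup.orderOf_mk, D.order]
  generates := fun x => by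
    obtain ⟨i, hi⟩ := exists_eq_pow_of_mem_zpowers x.2
    exact ⟨i, Subtype.ext hi⟩
  smul_u := D.rot_u
  smul_v := D.rot_v

omit [Fintype G] in
lemma pow_smul_u (i : ℕ) : g ^ i • u = ω ^ i • u := by
  induction i with
  | zero => simp
  | succ i ih => rw [pow_succ, mul_smul, D.rot_u, smul_comm, ih, smul_smul, pow_succ']

omit [Fintype G] in
lemma pow_smul_v (i : ℕ) : g ^ i • v = ω⁻¹ ^ i • v := by
  induction i with
  | zero => simp
  | succ i ih => rw [pow_succ, mul_smul, D.rot_v, smul_comm, ih, smul_smul, pow_succ']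

omit [Fintype G] in
lemma smul_mem_Homog_one (x : G) : x • u ∈ Homog k u v 1 ∧ x • v ∈ Homog k u v 1 := by
  obtain ⟨i, rfl | rfl⟩ := D.generates x
  · rw [D.pow_smul_u, D.pow_smul_v]
    exact ⟨Submodule.smul_mem _ _ u_mem_Homog, Submodule.smul_mem _ _ v_mem_Homog⟩
  · rw [mul_smul, mul_smul, D.refl_u, D.refl_v, D.pow_smul_u, D.pow_smul_v]
    exact ⟨Submodule.smul_mem _ _ v_mem_Homog, Submodule.smul_mem _ _ u_mem_Homog⟩

lemma smul_uv_of_mem {y : G} (hy : y ∈ Subgroup.zpowers g) : y • (u * v) = u * v := by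
  obtain ⟨i, rfl⟩ := exists_eq_pow_of_mem_zpowers hy
  rw [smul_mul', D.pow_smul_u, D.pow_smul_v, smul_mul_smul_comm, ← mul_pow,
    mul_inv_cancel₀ (D.prim.ne_zero D.pos.ne'), one_pow, one_smul]

omit [Fintype G] in
lemma smul_uv_of_notMem (hA : IsPBW (-1 : k) 0 u v) {y : G} (hy : y ∉ Subgroup.zpowers g) :
    y • (u * v) = -(u * v) := by
  obtain ⟨i, rfl⟩ := D.exists_eq_of_notMem hy
  rw [mul_smul, smul_mul' h, D.refl_u, D.refl_v, smul_mul', D.pow_smul_u, D.pow_smul_v,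
    smul_mul_smul_comm, ← mul_pow, inv_mul_cancel₀ (D.prim.ne_zero D.pos.ne'), one_pow, one_smul,
    hA.v_mul_u]

lemma smul_u_pow_of_mem {y : G} (hy : y ∈ Subgroup.zpowers g) :
    y • u ^ (2 * n) = u ^ (2 * n) := by
  obtain ⟨i, rfl⟩ := exists_eq_pow_of_mem_zpowers hy
  rw [smul_pow', D.pow_smul_u, smul_pow, ← pow_mul, mul_comm, mul_assoc, pow_mul',
    pow_mul, D.prim.pow_eq_one, one_pow, one_pow, one_smul]

omit [Fintype G] in
lemma smul_u_pow_of_notMem {y : G} (hy : y ∉ Subgroup.zpowers g) :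
    y • u ^ (2 * n) = v ^ (2 * n) := by
  obtain ⟨i, rfl⟩ := D.exists_eq_of_notMem hy
  rw [mul_smul, smul_pow' h, D.refl_u, smul_pow', D.pow_smul_v, smul_pow, ← pow_mul, mul_comm i,
    mul_assoc, pow_mul', pow_mul, pow_mul, inv_pow, D.prim.pow_eq_one]
  simp

omit [Fintype G] [SMulCommClass G k A] in
lemma v_pow_sub_u_pow_ne_zero (hA : IsPBW (-1 : k) 0 u v) : v ^ (2 * n) - u ^ (2 * n) ≠ 0 := by
  intro h0
  have h1 : mon u v (toLex (2 * n, 0)) = mon u v (toLex (0, 2 * n)) := by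
    simpa [mon, sub_eq_zero] using h0
  have h2 := congrArg (fun m => (ofLex m).1) (hA.linearIndependent.injective h1)
  have := D.pos
  simp at h2
  omega

variable (H : IsSkewGroupRing A G T ι j) (hA : IsPBW (-1 : k) 0 u v)
include H hA

lemma exists_mem_supportedOn {L : AddSubgroup T} (hL : IsTwoSided L) (hL0 : L ≠ ⊥) :
    ∃ t ∈ L, t ∈ H.supportedOn (Subgroup.zpowers g) ∧ t ≠ 0 := by
  obtain ⟨l, y, hl, hy, hly⟩ : ∃ l y, l ∈ L ∧ y ∈ Subgroup.zpowers g ∧ H.coef l y ≠ 0 := by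
    obtain ⟨⟨l, hl⟩, hl0⟩ := AddSubgroup.ne_bot_iff_exists_ne_zero.1 hL0
    obtain ⟨y, hy⟩ : ∃ y, H.coef l y ≠ 0 := by
      by_contra! hno
      exact hl0 (Subtype.ext (H.ext fun y => by rw [hno y]; exact (H.coef_zero y).symm))
    by_cases hyC : y ∈ Subgroup.zpowers g
    · exact ⟨l, y, hl, hyC, hy⟩
    · obtain ⟨i, rfl⟩ := D.exists_eq_of_notMem hyC
      exact ⟨l * j h⁻¹, g ^ i, hL.mul_right _ _ hl, pow_mem (Subgroup.mem_zpowers g) i,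
        by rwa [H.coef_mul_j, inv_inv]⟩
  have hcoef : ∀ x, H.coef (ι (v ^ (2 * n)) * l - l * ι (u ^ (2 * n))) x =
      (v ^ (2 * n) - x • u ^ (2 * n)) * H.coef l x := fun x => by
    rw [H.coef_sub, H.coef_ι_mul, H.coef_mul_ι, sub_mul]
    by_cases hx : x ∈ Subgroup.zpowers g
    · rw [D.smul_u_pow_of_mem hx, (hA.commute_u_pow n _).eq]
    · rw [D.smul_u_pow_of_notMem hx, (hA.commute_v_pow n _).eq]
  refine ⟨_, sub_mem (hL.mul_left (ι (v ^ (2 * n))) l hl) (hL.mul_right (ι (u ^ (2 * n))) l hl),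
    fun x hx => ?_, fun h0 => ?_⟩
  · rw [hcoef, D.smul_u_pow_of_notMem hx, sub_self, zero_mul]
  · have h1 := hcoef y
    rw [h0, H.coef_zero, D.smul_u_pow_of_mem hy] at h1
    exact hly (hA.eq_zero_of_mul_eq_zero (D.v_pow_sub_u_pow_ne_zero hA) h1.symm)

lemma exists_eq_of_mem_supportedOn [CharZero k] {Q : Type*} [Ring Q] {f : T →+* Q}
    (hf : IsGoldieQuotientRing f) {L : AddSubgroup T} (hL : IsTwoSided L) (hL0 : L ≠ ⊥)
    {z : A} (hz0 : z ≠ 0) {y : Q} {s : T} (hs : s ∈ H.supportedOn (Subgroup.zpowers g))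
    (hzy : f (ι z) * y = f s) (hy : ∀ b ∈ L, ∃ c ∈ L, y * f b = f c) :
    ∃ t ∈ H.supportedOn (Subgroup.zpowers g), s = ι z * t := by
  classical
  let S := H.supportedOn (Subgroup.zpowers g)
  have hu : IsUnit (f (ι z)) := hf.isUnit_of_regular _ (isRegular_ι H hA hz0)
  have hL' : IsTwoSided (L.comap S.subtype.toAddMonoidHom) :=
    ⟨fun t a ha => hL.mul_left t a ha, fun t a ha => hL.mul_right t a ha⟩
  obtain ⟨b, hb, hbS, hb0⟩ := D.exists_mem_supportedOn H hA hL hL0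
  have hL0' : L.comap S.subtype.toAddMonoidHom ≠ ⊥ :=
    AddSubgroup.ne_bot_of_mem (a := ⟨b, hbS⟩) hb fun h0 => hb0 (congrArg Subtype.val h0)
  obtain ⟨t, ht⟩ := D.isDiagonalAction.exists_eq_of_stable
    (H.isSkewGroupRing_supportedOn (Subgroup.zpowers g)) hA (f := f.comp S.subtype)
    (hf.injective.comp Subtype.val_injective) hL' hL0' hz0
    (fun y hy => hu.mul_right_eq_zero.1 hy) (x := y) (a := ⟨s, hs⟩) hzy
    (fun b hb => by
      obtain ⟨c, hc, hyc⟩ := hy _ hb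
      have hzc : ι z * c = s * b := hf.injective (by
        rw [map_mul, map_mul, ← hzy, mul_assoc, ← hyc]
        rfl)
      refine ⟨⟨c, fun x hx => hA.eq_zero_of_mul_eq_zero hz0 ?_⟩, hc, hyc⟩
      rw [← H.coef_ι_mul, hzc]
      exact S.mul_mem hs b.2 x hx)
  exact ⟨t, t.2, hf.injective (by rw [map_mul, ← hzy, ht]; rfl)⟩

lemma exists_coef_eq [CharZero k] {Q : Type*} [Ring Q] {f : T →+* Q}
    (hf : IsGoldieQuotientRing f) {L : AddSubgroup T} (hL : IsTwoSided L) (hL0 : L ≠ ⊥)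
    {d e : ℕ} {z : A} (hz : z ∈ Homog k u v d) (hz0 : z ≠ 0) {a : T}
    (ha : a ∈ H.coeffsIn (Homog k u v e)) {x : Q} (hzx : f (ι z) * x = f a)
    (hx : ∀ b ∈ L, ∃ c ∈ L, x * f b = f c) {y : G} (hy : y ∈ Subgroup.zpowers g) :
    ∃ b, H.coef a y = z * b := by
  set ε : ℤ := (-1) ^ d with hε
  set δ : ℤ := (-1) ^ e with hδ
  have hεε : ε * ε = 1 := by rw [hε, ← mul_pow]; simp
  have hδδ : δ * δ = 1 := by rw [hδ, ← mul_pow]; simp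
  have hWz : u * v * z = ε • (z * (u * v)) := hA.uv_mul hz
  have hzW : z * (u * v) = ε • (u * v * z) := by rw [hWz, smul_smul, hεε, one_smul]
  have haW : ∀ y, H.coef a y * (u * v) = δ • (u * v * H.coef a y) := fun y => by
    rw [hA.uv_mul (ha y), ← hδ, smul_smul, hδδ, one_smul]
  set s₁ : T := ε • (ι (u * v) * a) + (ε * δ) • (a * ι (u * v)) with hs₁
  set s₂ : T := ι (v ^ (2 * n)) * a - a * ι (u ^ (2 * n)) with hs₂
  have hcoef₁ : ∀ y, H.coef s₁ y =
      ε • (u * v * H.coef a y) + (ε * δ) • (H.coef a y * y • (u * v)) := fun y => by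
    have h1 : ∀ (m : ℤ) (t : T), H.coef (m • t) y = m • H.coef t y :=
      fun m t => map_zsmul (H.coefHom y) m t
    rw [hs₁, H.coef_add, h1, h1, H.coef_ι_mul, H.coef_mul_ι]
  have hcoef₂ : ∀ y, H.coef s₂ y =
      v ^ (2 * n) * H.coef a y - H.coef a y * y • u ^ (2 * n) := fun y => by
    rw [hs₂, H.coef_sub, H.coef_ι_mul, H.coef_mul_ι]
  obtain ⟨b₁, -, hb₁⟩ := D.exists_eq_of_mem_supportedOn H hA hf hL hL0 hz0 (s := s₁)
    (y := f (ι (u * v)) * x + (ε * δ) • (x * f (ι (u * v))))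
    (fun x hx => by
      rw [hcoef₁, D.smul_uv_of_notMem hA hx, mul_neg, haW, smul_neg, smul_smul, mul_assoc ε,
        hδδ, mul_one, add_neg_cancel])
    (by
      rw [mul_add, ← mul_assoc, ← map_mul, ← map_mul, hzW, map_zsmul, map_zsmul, smul_mul_assoc,
        map_mul ι, map_mul f, mul_assoc, hzx, mul_smul_comm, ← mul_assoc, hzx, hs₁, map_add f,
        map_zsmul f, map_zsmul f, map_mul f, map_mul f])
    (fun b hb => by
      obtain ⟨c, hc, hxc⟩ := hx b hb
      obtain ⟨c', hc', hxc'⟩ := hx _ (hL.mul_left (ι (u * v)) b hb)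
      refine ⟨ι (u * v) * c + (ε * δ) • c',
        add_mem (hL.mul_left _ _ hc) (zsmul_mem hc' _), ?_⟩
      rw [add_mul, mul_assoc, hxc, smul_mul_assoc, mul_assoc, ← map_mul f _ b, hxc', map_add f,
        map_zsmul, map_mul f])
  obtain ⟨b₂, -, hb₂⟩ := D.exists_eq_of_mem_supportedOn H hA hf hL hL0 hz0 (s := s₂)
    (y := f (ι (v ^ (2 * n))) * x - x * f (ι (u ^ (2 * n))))
    (fun x hx => by
      rw [hcoef₂, D.smul_u_pow_of_notMem hx, (hA.commute_v_pow n _).eq, sub_self])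
    (by
      rw [mul_sub, ← mul_assoc, ← map_mul, ← map_mul, ← (hA.commute_v_pow n z).eq,
        map_mul, map_mul, mul_assoc, hzx, ← mul_assoc, hzx, hs₂, map_sub, map_mul, map_mul])
    (fun b hb => by
      obtain ⟨c, hc, hxc⟩ := hx b hb
      obtain ⟨c', hc', hxc'⟩ := hx _ (hL.mul_left (ι (u ^ (2 * n))) b hb)
      refine ⟨ι (v ^ (2 * n)) * c - c', sub_mem (hL.mul_left _ _ hc) hc', ?_⟩
      rw [sub_mul, mul_assoc, hxc, mul_assoc, ← map_mul f _ b, hxc', map_sub, map_mul])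
  have e₁ : (2 * ε) • (u * v * H.coef a y) = z * H.coef b₁ y := by
    rw [← H.coef_ι_mul z, ← hb₁, hcoef₁, D.smul_uv_of_mem hy, haW, smul_smul, mul_assoc ε, hδδ,
      mul_one, two_mul, add_smul]
  have e₂ : (v ^ (2 * n) - u ^ (2 * n)) * H.coef a y = z * H.coef b₂ y := by
    rw [← H.coef_ι_mul z, ← hb₂, hcoef₂, D.smul_u_pow_of_mem hy, sub_mul, (hA.commute_u_pow n _).eq]
  have hcomm : ∀ b, Commute (v ^ (2 * n) - u ^ (2 * n)) b := fun b =>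
    (hA.commute_v_pow n b).sub_left (hA.commute_u_pow n b)
  have e₃ : (v ^ (2 * n) - u ^ (2 * n)) * H.coef b₁ y = u * v * ((2 : ℤ) • H.coef b₂ y) := by
    refine sub_eq_zero.1 (hA.eq_zero_of_mul_eq_zero hz0 ?_)
    rw [mul_sub, ← mul_assoc, ← (hcomm z).eq, mul_assoc, ← e₁, ← mul_assoc z, hzW, mul_smul_comm,
      ← mul_assoc, (hcomm _).eq, mul_assoc, e₂]
    simp only [smul_mul_assoc, mul_smul_comm, smul_smul, mul_assoc, sub_self]
  obtain ⟨c, hc⟩ := hA.exists_eq_uv_mul_of_eq (Nat.mul_pos two_pos D.pos) e₃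
  have e₄ : (2 : ℤ) • H.coef a y = z * c := by
    refine sub_eq_zero.1 (hA.eq_zero_of_mul_eq_zero (a := u * v)
      (hA.mul_ne_zero hA.u_ne_zero hA.v_ne_zero) ?_)
    rw [mul_sub, mul_smul_comm, ← mul_assoc, hWz, smul_mul_assoc, mul_assoc z, ← hc, ← e₁, smul_smul,
      mul_left_comm, hεε, mul_one, sub_self]
  refine ⟨(2 : k)⁻¹ • c, ?_⟩
  rw [mul_smul_comm, ← e₄, ← Int.cast_smul_eq_zsmul k, smul_smul]
  simp

theorem leftStable [CharZero k] {Q : Type*} [Ring Q] {f : T →+* Q}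
    (hf : IsGoldieQuotientRing f) : LeftStable f := by
  refine H.leftStable_of_homog hA D.smul_mem_Homog_one hf
    fun L hL hL0 d z hz hz0 e a ha x hzx hx => ?_
  have key : ∀ y, ∃ b, H.coef a y = z * b := by
    intro y
    by_cases hy : y ∈ Subgroup.zpowers g
    · exact D.exists_coef_eq H hA hf hL hL0 hz hz0 ha hzx hx hy
    · obtain ⟨i, rfl⟩ := D.exists_eq_of_notMem hy
      have := D.exists_coef_eq H hA hf hL hL0 hz hz0 (a := a * j h⁻¹) (x := x * f (j h⁻¹))
        (fun y => by rw [H.coef_mul_j]; exact ha _) (by rw [← mul_assoc, hzx, map_mul])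
        (fun b hb => by
          obtain ⟨c, hc, hxc⟩ := hx _ (hL.mul_left (j h⁻¹) b hb)
          exact ⟨c, hc, by rw [mul_assoc, ← map_mul, hxc]⟩)
        (pow_mem (Subgroup.mem_zpowers g) i)
      rwa [H.coef_mul_j, inv_inv] at this
  choose b hb using key
  exact ⟨∑ y, ι (b y) * j y, H.ext fun y => by rw [H.coef_ι_mul, H.coef_sum, hb]⟩

end IsDihedralAction

end Dihedral

section Construction

variable {k A : Type*} [Field k] [Ring A] [Algebra k A] {q p : k} {u v : A}

lemma top_le_span_mon (rel : v * u = q • (u * v) + p • (u * u))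
    (hadj : Algebra.adjoin k {u, v} = ⊤) : ⊤ ≤ Submodule.span k (Set.range (mon u v)) := by
  have key : ∀ x ∈ Algebra.adjoin k {u, v}, ∀ s ∈ Submodule.span k (Set.range (mon u v)),
      x * s ∈ Submodule.span k (Set.range (mon u v)) := by
    intro x hx
    induction hx using Algebra.adjoin_induction with
    | mem x hx =>
      intro s hs
      induction hs using Submodule.span_induction with
      | mem s hs =>
        obtain ⟨m, rfl⟩ := hs
        rcases hx with rfl | rfl
        · rw [u_mul_mon]
          exact Submodule.subset_span ⟨_, rfl⟩
        · obtain ⟨c, hc⟩ := exists_v_mul_mon rel m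
          rw [hc]
          exact add_mem (Submodule.smul_mem _ _ (Submodule.subset_span ⟨_, rfl⟩))
            (Submodule.smul_mem _ _ (Submodule.subset_span ⟨_, rfl⟩))
      | zero => simp
      | add s t _ _ hs ht => rw [mul_add]; exact add_mem hs ht
      | smul c s _ hs => rw [mul_smul_comm]; exact Submodule.smul_mem _ _ hs
    | algebraMap c =>
      intro s hs
      rw [← Algebra.smul_def]
      exact Submodule.smul_mem _ _ hs
    | add x y _ _ hx hy => intro s hs; rw [add_mul]; exact add_mem (hx s hs) (hy s hs)
    | mul x y _ _ hx hy => intro s hs; rw [mul_assoc]; exact hx _ (hy s hs)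
  intro x _
  have h1 : (1 : A) ∈ Submodule.span k (Set.range (mon u v)) :=
    Submodule.subset_span ⟨0, by simp [mon]⟩
  simpa using key x (hadj ▸ Algebra.mem_top) 1 h1

variable (k) in
/-- Left multiplication by `u` on the monomial basis. -/
noncomputable def uEnd : Module.End k ((ℕ ×ₗ ℕ) →₀ k) :=
  Finsupp.linearCombination k fun m => Finsupp.single (toLex (0, 1) + m) 1

/-- Left multiplication by `v` on the monomial basis. -/
noncomputable def vEnd (q p : k) : Module.End k ((ℕ ×ₗ ℕ) →₀ k) :=
  Finsupp.linearCombination k fun m =>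
    q ^ (ofLex m).2 • Finsupp.single (toLex (1, 0) + m) 1 +
      (p * ∑ l ∈ Finset.range (ofLex m).2, q ^ l) • Finsupp.single (toLex (0, 1) + m) 1

lemma uEnd_single (m : ℕ ×ₗ ℕ) :
    uEnd k (Finsupp.single m 1) = Finsupp.single (toLex (0, 1) + m) 1 := by
  simp [uEnd]

lemma vEnd_single (m : ℕ ×ₗ ℕ) : vEnd q p (Finsupp.single m 1) =
    q ^ (ofLex m).2 • Finsupp.single (toLex (1, 0) + m) 1 +
      (p * ∑ l ∈ Finset.range (ofLex m).2, q ^ l) • Finsupp.single (toLex (0, 1) + m) 1 := by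
  simp [vEnd]

lemma vEnd_mul_uEnd (q p : k) :
    vEnd q p * uEnd k = q • (uEnd k * vEnd q p) + p • (uEnd k * uEnd k) := by
  refine Finsupp.basisSingleOne.ext fun m => ?_
  have h1 : (ofLex (toLex (0, 1) + m)).2 = (ofLex m).2 + 1 := add_comm _ _
  simp only [Finsupp.coe_basisSingleOne, Module.End.mul_apply, LinearMap.add_apply,
    LinearMap.smul_apply, uEnd_single, vEnd_single, map_add, map_smul, h1, geom_sum_succ]
  rw [add_left_comm (toLex (1, 0)) (toLex (0, 1)) m]
  module

lemma uEnd_pow_single (i : ℕ) (m : ℕ ×ₗ ℕ) :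
    (uEnd k ^ i) (Finsupp.single m 1) = Finsupp.single (toLex (0, i) + m) 1 := by
  induction i with
  | zero =>
    have : (toLex (0, 0) : ℕ ×ₗ ℕ) = 0 := rfl
    simp [this]
  | succ i ih =>
    rw [pow_succ', Module.End.mul_apply, ih, uEnd_single, ← add_assoc, ← toLex_add,
      Prod.mk_add_mk, add_comm 1 i]

lemma vEnd_pow_single (j : ℕ) :
    (vEnd q p ^ j) (Finsupp.single 0 1) = Finsupp.single (toLex (j, 0)) 1 := by
  induction j with
  | zero => rfl
  | succ j ih =>
    rw [pow_succ', Module.End.mul_apply, ih, vEnd_single, ← toLex_add, Prod.mk_add_mk,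
      add_comm 1 j]
    simp

lemma linearIndependent_mon (ρ : A →ₐ[k] Module.End k ((ℕ ×ₗ ℕ) →₀ k)) (hu : ρ u = uEnd k)
    (hv : ρ v = vEnd q p) : LinearIndependent k (mon u v) := by
  refine LinearIndependent.of_comp
    ((LinearMap.applyₗ (Finsupp.single (0 : ℕ ×ₗ ℕ) (1 : k))).comp ρ.toLinearMap) ?_
  convert (Finsupp.basisSingleOne (R := k) (ι := ℕ ×ₗ ℕ)).linearIndependent
  ext1 m
  simp only [Function.comp_apply, LinearMap.comp_apply, AlgHom.toLinearMap_apply,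
    LinearMap.applyₗ_apply_apply, mon, map_mul, map_pow, hu, hv, Module.End.mul_apply,
    vEnd_pow_single, uEnd_pow_single, toLex_split, Finsupp.coe_basisSingleOne]

lemma adjoin_mkAlgHom_eq_top (r : FreeAlgebra k (Fin 2) → FreeAlgebra k (Fin 2) → Prop) :
    Algebra.adjoin k {RingQuot.mkAlgHom k r (FreeAlgebra.ι k 0),
      RingQuot.mkAlgHom k r (FreeAlgebra.ι k 1)} = ⊤ := by
  have h : ({RingQuot.mkAlgHom k r (FreeAlgebra.ι k 0),
      RingQuot.mkAlgHom k r (FreeAlgebra.ι k 1)} : Set (RingQuot r)) =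
      RingQuot.mkAlgHom k r '' Set.range (FreeAlgebra.ι k) := by
    ext x
    simp [eq_comm]
  rw [h, ← AlgHom.map_adjoin, FreeAlgebra.adjoin_range_ι, Algebra.map_top,
    AlgHom.range_eq_top]
  exact RingQuot.mkAlgHom_surjective k r

theorem QuantumPlane.isPBW (hq : q ≠ 0) : IsPBW q 0 (qU k q) (qV k q) := by
  have rel : qV k q * qU k q = q • (qU k q * qV k q) + (0 : k) • (qU k q * qU k q) := by
    have := RingQuot.mkAlgHom_rel k (QuantumRel.rel (K := k) (q := q))
    simpa [qU, qV] using this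
  refine ⟨hq, rel, ?_, top_le_span_mon rel (adjoin_mkAlgHom_eq_top _)⟩
  refine linearIndependent_mon (q := q) (p := 0) (RingQuot.liftAlgHom k
    ⟨FreeAlgebra.lift k ![uEnd k, vEnd q 0], ?_⟩) ?_ ?_
  · rintro _ _ ⟨⟩
    simpa using vEnd_mul_uEnd q 0
  · simp [qU]
  · simp [qV]

theorem JordanPlane.isPBW : IsPBW (1 : k) 1 (jU k) (jV k) := by
  have rel : jV k * jU k = (1 : k) • (jU k * jV k) + (1 : k) • (jU k * jU k) := by
    have := RingQuot.mkAlgHom_rel k (JordanRel.rel (K := k))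
    simpa [jU, jV] using this
  refine ⟨one_ne_zero, rel, ?_, top_le_span_mon rel (adjoin_mkAlgHom_eq_top _)⟩
  refine linearIndependent_mon (q := 1) (p := 1) (RingQuot.liftAlgHom k
    ⟨FreeAlgebra.lift k ![uEnd k, vEnd 1 1], ?_⟩) ?_ ?_
  · rintro _ _ ⟨⟩
    simpa using vEnd_mul_uEnd (1 : k) 1
  · simp [jU]
  · simp [jV]

namespace IsPBW

lemma linearIndependent_of_isLead (h : IsPBW q p u v) {w : ℕ ×ₗ ℕ → A}
    (hw : ∀ m, IsLead k u v (w m) m) : LinearIndependent k w := by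
  rw [linearIndependent_iff]
  intro l hl
  by_contra hne
  have hs : l.support.Nonempty := Finsupp.support_nonempty_iff.2 hne
  set m := l.support.max' hs with hm
  have h1 := congrArg (fun a => h.basis.repr a m) hl
  simp only [Finsupp.linearCombination_apply, Finsupp.sum, map_sum, map_smul,
    Finsupp.finsetSum_apply, Finsupp.smul_apply, map_zero, Finsupp.zero_apply] at h1
  rw [Finset.sum_eq_single m] at h1
  · exact smul_ne_zero (Finsupp.mem_support_iff.1 (l.support.max'_mem hs))
      (h.isLead_iff.1 (hw m)).1 h1
  · intro m' hm' hne'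
    rw [(h.isLead_iff.1 (hw m')).2 m (lt_of_le_of_ne (l.support.le_max' _ hm') hne'), smul_zero]
  · exact fun hn => absurd (l.support.max'_mem hs) hn

theorem op (h : IsPBW q p u v) :
    IsPBW q⁻¹ (-(q⁻¹ * p)) (MulOpposite.op u) (MulOpposite.op v) := by
  have hrel : MulOpposite.op v * MulOpposite.op u = q⁻¹ • (MulOpposite.op u * MulOpposite.op v) +
      (-(q⁻¹ * p)) • (MulOpposite.op u * MulOpposite.op u) := by
    rw [← MulOpposite.op_mul, ← MulOpposite.op_mul, ← MulOpposite.op_mul, h.rel,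
      MulOpposite.op_add, MulOpposite.op_smul, MulOpposite.op_smul, smul_add, smul_smul,
      smul_smul, inv_mul_cancel₀ h.q_ne]
    module
  refine ⟨inv_ne_zero h.q_ne, hrel, ?_, top_le_span_mon hrel ?_⟩
  · have h1 : LinearIndependent k fun m : ℕ ×ₗ ℕ => v ^ (ofLex m).1 * u ^ (ofLex m).2 := by
      refine h.linearIndependent_of_isLead fun m => ?_
      have h2 := v_pow_mul_lead h.q_ne h.rel (ofLex m).1
        (isLead_mon (k := k) (u := u) (v := v) (toLex (0, (ofLex m).2)))
      simpa [mon, ← toLex_add] using h2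
    exact h1.map' (MulOpposite.opLinearEquiv k).toLinearMap (LinearEquiv.ker _)
  · rw [eq_top_iff]
    rintro x -
    have h1 := h.span (x := x.unop) trivial
    rw [← MulOpposite.op_unop x]
    generalize x.unop = y at h1
    induction h1 using Submodule.span_induction with
    | mem y hy =>
      obtain ⟨m, rfl⟩ := hy
      rw [mon, MulOpposite.op_mul, MulOpposite.op_pow, MulOpposite.op_pow]
      exact mul_mem (pow_mem (Algebra.subset_adjoin (by simp)) _)
        (pow_mem (Algebra.subset_adjoin (by simp)) _)
    | zero => simp
    | add y z _ _ hy hz => rw [MulOpposite.op_add]; exact add_mem hy hz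
    | smul c y _ hy => rw [MulOpposite.op_smul]; exact Subalgebra.smul_mem _ hy c

end IsPBW

end Construction

section Final

variable {k A G T : Type*} [Field k] [Ring A] [Algebra k A] [Group G] [Fintype G]
  [MulSemiringAction G A] [SMulCommClass G k A] [Ring T] {ι : A →+* T} {j : G → T}
  {q p : k} {u v : A} {n : ℕ} {ω : k} {g h : G}

theorem IsDiagonalAction.isMaximalOrder [CharZero k] (D : IsDiagonalAction n ω g u v)
    (H : IsSkewGroupRing A G T ι j) (hA : IsPBW q p u v) {Q : Type*} [Ring Q] {f : T →+* Q}
    (hf : IsGoldieQuotientRing f) : IsMaximalOrder f := by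
  refine isMaximalOrder_of_leftStable f (D.leftStable H hA hf) ?_
  let := opMulSemiringAction G A
  have : SMulCommClass G k Aᵐᵒᵖ :=
    ⟨fun x c a => MulOpposite.unop_injective (smul_comm x c a.unop)⟩
  have D' : IsDiagonalAction n ω g (MulOpposite.op u) (MulOpposite.op v) :=
    { pos := D.pos
      prim := D.prim
      order := D.order
      generates := D.generates
      smul_u := congrArg MulOpposite.op D.smul_u
      smul_v := congrArg MulOpposite.op D.smul_v }
  exact D'.leftStable H.op hA.op hf.op

theorem IsDihedralAction.isMaximalOrder [CharZero k] (D : IsDihedralAction n ω g h u v)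
    (H : IsSkewGroupRing A G T ι j) (hA : IsPBW (-1 : k) 0 u v) {Q : Type*} [Ring Q] {f : T →+* Q}
    (hf : IsGoldieQuotientRing f) : IsMaximalOrder f := by
  refine isMaximalOrder_of_leftStable f (D.leftStable H hA hf) ?_
  let := opMulSemiringAction G A
  have : SMulCommClass G k Aᵐᵒᵖ :=
    ⟨fun x c a => MulOpposite.unop_injective (smul_comm x c a.unop)⟩
  have D' : IsDihedralAction n ω g h (MulOpposite.op u) (MulOpposite.op v) :=
    { pos := D.pos
      prim := D.prim
      order := D.order
      generates := D.generates
      rot_u := congrArg MulOpposite.op D.rot_u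
      rot_v := congrArg MulOpposite.op D.rot_v
      refl_u := congrArg MulOpposite.op D.refl_u
      refl_v := congrArg MulOpposite.op D.refl_v }
  have hA' : IsPBW (-1 : k) 0 (MulOpposite.op u) (MulOpposite.op v) := by
    have := hA.op
    rwa [mul_zero, neg_zero, inv_neg_one] at this
  exact D'.leftStable H.op hA' hf.op

end Final

/-- For every quantum Kleinian pair `(A, G)`, the skew group ring `A # G` is a
maximal order. -/
theorem quantumKleinian_skewGroupRing_maximalOrder
    (k : Type) [Field k] [IsAlgClosed k] [CharZero k] :
    (∀ (n : ℕ), 0 < n → ∀ ω : k, IsPrimitiveRoot ω n → ∀ q : k, q ≠ 0 →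
      ∀ (G : Type) [Group G] [Fintype G], ∀ g : G,
        orderOf g = n → (∀ x : G, ∃ i : ℕ, x = g ^ i) →
      ∀ [MulSemiringAction G (QuantumPlane k q)] [SMulCommClass G k (QuantumPlane k q)],
        g • qU k q = ω • qU k q → g • qV k q = ω⁻¹ • qV k q →
      ∀ (T : Type) [Ring T] (iota : (QuantumPlane k q) →+* T) (j : G → T),
        IsSkewGroupRing (QuantumPlane k q) G T iota j →
        ∀ (Q : Type) [Ring Q], ∀ f : T →+* Q, IsGoldieQuotientRing f →
          IsMaximalOrder f) ∧
    (∀ (G : Type) [Group G] [Fintype G], ∀ h : G,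
        orderOf h = 2 → (∀ x : G, x = 1 ∨ x = h) →
      ∀ [MulSemiringAction G (QuantumPlane k (-1 : k))] [SMulCommClass G k (QuantumPlane k (-1 : k))],
        h • qU k (-1 : k) = qV k (-1 : k) → h • qV k (-1 : k) = qU k (-1 : k) →
      ∀ (T : Type) [Ring T] (iota : (QuantumPlane k (-1 : k)) →+* T) (j : G → T),
        IsSkewGroupRing (QuantumPlane k (-1 : k)) G T iota j →
        ∀ (Q : Type) [Ring Q], ∀ f : T →+* Q, IsGoldieQuotientRing f →
          IsMaximalOrder f) ∧
    (∀ (n : ℕ), 0 < n → ∀ ω : k, IsPrimitiveRoot ω n →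
      ∀ (G : Type) [Group G] [Fintype G], ∀ g h : G,
        orderOf g = n → orderOf h = 2 → h * g * h = g⁻¹ →
        Fintype.card G = 2 * n →
        (∀ x : G, ∃ i : ℕ, x = g ^ i ∨ x = g ^ i * h) →
      ∀ [MulSemiringAction G (QuantumPlane k (-1 : k))] [SMulCommClass G k (QuantumPlane k (-1 : k))],
        g • qU k (-1 : k) = ω • qU k (-1 : k) →
        g • qV k (-1 : k) = ω⁻¹ • qV k (-1 : k) →
        h • qU k (-1 : k) = qV k (-1 : k) → h • qV k (-1 : k) = qU k (-1 : k) →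
      ∀ (T : Type) [Ring T] (iota : (QuantumPlane k (-1 : k)) →+* T) (j : G → T),
        IsSkewGroupRing (QuantumPlane k (-1 : k)) G T iota j →
        ∀ (Q : Type) [Ring Q], ∀ f : T →+* Q, IsGoldieQuotientRing f →
          IsMaximalOrder f) ∧
    (∀ (G : Type) [Group G] [Fintype G], ∀ h : G,
        orderOf h = 2 → (∀ x : G, x = 1 ∨ x = h) →
      ∀ [MulSemiringAction G (JordanPlane k)] [SMulCommClass G k (JordanPlane k)],
        h • jU k = - jU k → h • jV k = - jV k →
      ∀ (T : Type) [Ring T] (iota : (JordanPlane k) →+* T) (j : G → T),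
        IsSkewGroupRing (JordanPlane k) G T iota j →
        ∀ (Q : Type) [Ring Q], ∀ f : T →+* Q, IsGoldieQuotientRing f →
          IsMaximalOrder f) := by
  refine ⟨?_, ?_, ?_, ?_⟩
  · intro n hn ω hω q hq G _ _ g hg hgen _ _ hu hv T _ ι j H Q _ f hf
    exact IsDiagonalAction.isMaximalOrder ⟨hn, hω, hg, hgen, hu, hv⟩ H
      (QuantumPlane.isPBW hq) hf
  · intro G _ _ h hh hgen _ _ hu hv T _ ι j H Q _ f hf
    refine IsDihedralAction.isMaximalOrder (n := 1) (ω := (1 : k)) (g := 1) (h := h)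
      ⟨one_pos, IsPrimitiveRoot.one, orderOf_one, fun x => ⟨0, by simpa using hgen x⟩,
        by simp, by simp, hu, hv⟩ H (QuantumPlane.isPBW (by simp)) hf
  · intro n hn ω hω G _ _ g h hg _ _ _ hgen _ _ hgu hgv hu hv T _ ι j H Q _ f hf
    exact IsDihedralAction.isMaximalOrder ⟨hn, hω, hg, hgen, hgu, hgv, hu, hv⟩ H
      (QuantumPlane.isPBW (by simp)) hf
  · intro G _ _ h hh hgen _ _ hu hv T _ ι j H Q _ f hf
    refine IsDiagonalAction.isMaximalOrder (n := 2) (ω := (-1 : k)) (g := h)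
      ⟨two_pos, IsPrimitiveRoot.neg_one 0 (by simp), hh, fun x => ?_, ?_, ?_⟩ H
      JordanPlane.isPBW hf
    · rcases hgen x with rfl | rfl
      · exact ⟨0, by simp⟩
      · exact ⟨1, by simp⟩
    · exact hu.trans (neg_one_smul k (jU k)).symm
    · rw [hv, inv_neg_one]
      exact (neg_one_smul k (jV k)).symm
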